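/- arXiv:2504.05911 — 4 statements merged into one kernel-verified Lean document; each statement's English description precedes it below -/
import Mathlib

section
/- Fix an integer N ≥ 1 and a real number p > 1, and let β ∈ ℝ^N with |β| < 1. Suppose U is a smooth real-valued solution of the self-similar wave equation on ℝ × {y ∈ ℝ^N : |y| < 1}. Then for every s' ∈ ℝ and |y'| < 1 one has 1 − β·y' > 0 and the point y = ( y' − γβ + (γ²(β·y')/(1+γ)) β ) / ( γ(1 − β·y') ) satisfies |y| < 1, so that V := 𝒯_β U is well defined; moreover V is a smooth solution of the self-similar wave equation on ℝ × {y' ∈ ℝ^N : |y'| < 1}. -/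
open scoped RealInnerProductSpace

noncomputable section

/-- The constant `κ₀ = (2(p+1)/(p-1)²)^{1/(p-1)}`. -/
def kappa0 (p : ℝ) : ℝ := (2 * (p + 1) / (p - 1) ^ 2) ^ (1 / (p - 1))

/-- The boosted self-similar profile `κ_d(y) = κ₀ (1-|d|²)^{1/(p-1)} (1+d⬝y)^{-2/(p-1)}`. -/
def kd {N : ℕ} (p : ℝ) (d y : EuclideanSpace ℝ (Fin N)) : ℝ :=
  kappa0 p * (1 - ‖d‖ ^ 2) ^ (1 / (p - 1)) * (1 + ⟪d, y⟫) ^ (-(2 / (p - 1)))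

/-- Partial derivative of a real-valued function in the `i`-th coordinate direction. -/
def pd {N : ℕ} (i : Fin N) (f : EuclideanSpace ℝ (Fin N) → ℝ)
    (y : EuclideanSpace ℝ (Fin N)) : ℝ :=
  fderiv ℝ f y (EuclideanSpace.single i 1)

/-- Derivative in the first (time) variable. -/
def dT {N : ℕ} (u : ℝ × EuclideanSpace ℝ (Fin N) → ℝ) (t : ℝ)
    (x : EuclideanSpace ℝ (Fin N)) : ℝ := deriv (fun t' => u (t', x)) t

/-- Second derivative in the first (time) variable. -/
def dTT {N : ℕ} (u : ℝ × EuclideanSpace ℝ (Fin N) → ℝ) (t : ℝ)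
    (x : EuclideanSpace ℝ (Fin N)) : ℝ := deriv (fun t' => dT u t' x) t

/-- Spatial Laplacian. -/
def lapX {N : ℕ} (u : ℝ × EuclideanSpace ℝ (Fin N) → ℝ) (t : ℝ)
    (x : EuclideanSpace ℝ (Fin N)) : ℝ :=
  ∑ i : Fin N, pd i (pd i (fun z => u (t, z))) x

/-- `u` satisfies `∂ₜₜu − Δₓu = |u|^{p−1}u` at the point `q = (t, x)`. -/
def WaveEqAt {N : ℕ} (p : ℝ) (u : ℝ × EuclideanSpace ℝ (Fin N) → ℝ)
    (q : ℝ × EuclideanSpace ℝ (Fin N)) : Prop :=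
  dTT u q.1 q.2 - lapX u q.1 q.2 = |u q| ^ (p - 1) * u q

/-- `U` satisfies the self-similar wave equation at `(s, y)`. -/
def SSat {N : ℕ} (p : ℝ) (U : ℝ × EuclideanSpace ℝ (Fin N) → ℝ) (s : ℝ)
    (y : EuclideanSpace ℝ (Fin N)) : Prop :=
  dTT U s y + (p + 3) / (p - 1) * dT U s y
    + 2 * (∑ i : Fin N, y i * pd i (fun z => dT U s z) y)
    + 2 * (p + 1) / (p - 1) * (∑ i : Fin N, y i * pd i (fun z => U (s, z)) y)
    + (∑ i : Fin N, ∑ j : Fin N,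
        (y i * y j - if i = j then (1 : ℝ) else 0) * pd i (pd j (fun z => U (s, z))) y)
    + 2 * (p + 1) / (p - 1) ^ 2 * U (s, y)
    = |U (s, y)| ^ (p - 1) * U (s, y)

/-- `η` satisfies the linearized self-similar equation with potential `V` at `(s, y)`. -/
def LinEqAt {N : ℕ} (p : ℝ) (V : EuclideanSpace ℝ (Fin N) → ℝ)
    (η : ℝ × EuclideanSpace ℝ (Fin N) → ℝ) (s : ℝ)
    (y : EuclideanSpace ℝ (Fin N)) : Prop :=
  dTT η s y + (p + 3) / (p - 1) * dT η s y
    + 2 * (∑ i : Fin N, y i * pd i (fun z => dT η s z) y)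
    + 2 * (p + 1) / (p - 1) * (∑ i : Fin N, y i * pd i (fun z => η (s, z)) y)
    + (∑ i : Fin N, ∑ j : Fin N,
        (y i * y j - if i = j then (1 : ℝ) else 0) * pd i (pd j (fun z => η (s, z))) y)
    + (2 * (p + 1) / (p - 1) ^ 2 - V y) * η (s, y) = 0

/-- The Lorentz boost `Λ_β(t,x) = (γ(t − β⬝x), x − γβt + (γ²(β⬝x)/(1+γ))β)`,
with `γ = (1−|β|²)^{−1/2}`. -/
def boost {N : ℕ} (β : EuclideanSpace ℝ (Fin N)) (q : ℝ × EuclideanSpace ℝ (Fin N)) :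
    ℝ × EuclideanSpace ℝ (Fin N) :=
  (((1 - ‖β‖ ^ 2) ^ (-(1 / 2) : ℝ)) * (q.1 - ⟪β, q.2⟫),
    q.2 - (((1 - ‖β‖ ^ 2) ^ (-(1 / 2) : ℝ)) * q.1) • β
      + ((((1 - ‖β‖ ^ 2) ^ (-(1 / 2) : ℝ)) ^ 2 * ⟪β, q.2⟫)
          / (1 + (1 - ‖β‖ ^ 2) ^ (-(1 / 2) : ℝ))) • β)

/-- The spatial map `y' ↦ (y' − γβ + (γ²(β⬝y')/(1+γ))β) / (γ(1 − β⬝y'))` of the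
Lorentz transform in self-similar variables. -/
def ymap {N : ℕ} (β y' : EuclideanSpace ℝ (Fin N)) : EuclideanSpace ℝ (Fin N) :=
  (((1 - ‖β‖ ^ 2) ^ (-(1 / 2) : ℝ)) * (1 - ⟪β, y'⟫))⁻¹
    • (y' - ((1 - ‖β‖ ^ 2) ^ (-(1 / 2) : ℝ)) • β
        + ((((1 - ‖β‖ ^ 2) ^ (-(1 / 2) : ℝ)) ^ 2 * ⟪β, y'⟫)
            / (1 + (1 - ‖β‖ ^ 2) ^ (-(1 / 2) : ℝ))) • β)

/-- The Lorentz transform `𝒯_β` in self-similar variables: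
`(𝒯_β U)(s',y') = (γ(1 − β⬝y'))^{−2/(p−1)} U(s' − log(1 − β⬝y'), ymap β y')`. -/
def lorentzSS {N : ℕ} (p : ℝ) (β : EuclideanSpace ℝ (Fin N))
    (U : ℝ × EuclideanSpace ℝ (Fin N) → ℝ) (q : ℝ × EuclideanSpace ℝ (Fin N)) : ℝ :=
  (((1 - ‖β‖ ^ 2) ^ (-(1 / 2) : ℝ)) * (1 - ⟪β, q.2⟫)) ^ (-(2 / (p - 1)))
    * U (q.1 - Real.log (1 - ⟪β, q.2⟫), ymap β q.2)

/-- Partial derivative of a complex-valued function in the `i`-th coordinate direction. -/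
def pdC {N : ℕ} (i : Fin N) (f : EuclideanSpace ℝ (Fin N) → ℂ)
    (y : EuclideanSpace ℝ (Fin N)) : ℂ :=
  fderiv ℝ f y (EuclideanSpace.single i 1)

/-- The eigen-equation for `(d, λ)` at a point `y`. -/
def EigenEqAt {N : ℕ} (p : ℝ) (d : EuclideanSpace ℝ (Fin N)) (lam : ℂ)
    (φ : EuclideanSpace ℝ (Fin N) → ℂ) (y : EuclideanSpace ℝ (Fin N)) : Prop :=
  (lam ^ 2 + (((p + 3) / (p - 1) : ℝ) : ℂ) * lam + ((2 * (p + 1) / (p - 1) ^ 2 : ℝ) : ℂ)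
      - ((p * kd p d y ^ (p - 1) : ℝ) : ℂ)) * φ y
    + (2 * lam + ((2 * (p + 1) / (p - 1) : ℝ) : ℂ))
        * (∑ i : Fin N, (y i : ℂ) * pdC i φ y)
    + (∑ i : Fin N, ∑ j : Fin N,
        (((y i * y j - if i = j then (1 : ℝ) else 0) : ℝ) : ℂ) * pdC i (pdC j φ) y)
    = 0

/-- `λ` is an eigenvalue of the linearized operator around `κ_d`: the eigen-equation for
`(d, λ)` has a solution smooth on an open neighborhood of the closed unit ball that is
not identically zero on the closed unit ball. -/
def IsEigenvalue (N : ℕ) (p : ℝ) (d : EuclideanSpace ℝ (Fin N)) (lam : ℂ) : Prop :=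
  ∃ φ : EuclideanSpace ℝ (Fin N) → ℂ, ∃ Ω : Set (EuclideanSpace ℝ (Fin N)),
    IsOpen Ω ∧ Metric.closedBall 0 1 ⊆ Ω ∧ ContDiffOn ℝ (⊤ : ℕ∞) φ Ω ∧
    (∀ y ∈ Metric.closedBall (0 : EuclideanSpace ℝ (Fin N)) 1, EigenEqAt p d lam φ y) ∧
    ∃ y ∈ Metric.closedBall (0 : EuclideanSpace ℝ (Fin N)) 1, φ y ≠ 0


/-- The open forward cone. -/
def fcone (N : ℕ) : Set (ℝ × EuclideanSpace ℝ (Fin N)) := {q | ‖q.2‖ < q.1}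

theorem fcone_isOpen (N : ℕ) : IsOpen (fcone N) := by
  exact isOpen_lt (by fun_prop) (by fun_prop)

/-- The wave equation in bilinear form. -/
def WaveB {N : ℕ} (p : ℝ) (u : ℝ × EuclideanSpace ℝ (Fin N) → ℝ)
    (q : ℝ × EuclideanSpace ℝ (Fin N)) : Prop :=
  fderiv ℝ (fderiv ℝ u) q (1, 0) (1, 0)
    - ∑ i : Fin N, fderiv ℝ (fderiv ℝ u) q (0, EuclideanSpace.single i 1)
        (0, EuclideanSpace.single i 1)
    = |u q| ^ (p - 1) * u q

theorem mem_fcone {N : ℕ} (r : ℝ) (hr : 0 < r) (z : EuclideanSpace ℝ (Fin N)) (hz : ‖z‖ < 1) :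
    (r, r • z) ∈ fcone N := by
  simp only [fcone, Set.mem_setOf_eq, norm_smul, Real.norm_eq_abs, abs_of_pos hr]
  nlinarith

theorem sum_single {N : ℕ} (y : EuclideanSpace ℝ (Fin N)) :
    ∑ i : Fin N, y i • EuclideanSpace.single i (1 : ℝ) = y := by
  ext j
  simp [Finset.sum_apply, Pi.single_apply]

theorem lin_sum {N : ℕ} (y : EuclideanSpace ℝ (Fin N))
    (M : (ℝ × EuclideanSpace ℝ (Fin N)) →L[ℝ] ℝ) :
    ∑ i : Fin N, y i * M (0, EuclideanSpace.single i 1) = M (0, y) := by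
  have h : (0, y) = ∑ i : Fin N, y i • ((0 : ℝ), EuclideanSpace.single i (1 : ℝ)) := by
    apply Prod.ext
    · simp [Prod.fst_sum]
    · rw [Prod.snd_sum]; simp [sum_single]
  rw [h, map_sum]
  exact Finset.sum_congr rfl fun i _ => by rw [map_smul, smul_eq_mul]

theorem pd_scaled {N : ℕ} (f : ℝ × EuclideanSpace ℝ (Fin N) → ℝ)
    (h : EuclideanSpace ℝ (Fin N) → ℝ) (C r : ℝ) (hr : 0 < r)
    (hf : ∀ q ∈ fcone N, DifferentiableAt ℝ f q)
    (hh : ∀ z : EuclideanSpace ℝ (Fin N), ‖z‖ < 1 → h z = C * f (r, r • z))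
    (i : Fin N) (y : EuclideanSpace ℝ (Fin N)) (hy : ‖y‖ < 1) :
    pd i h y = C * r * fderiv ℝ f (r, r • y) (0, EuclideanSpace.single i 1) := by
  have hev : h =ᶠ[nhds y] fun z => C * f (r, r • z) := by
    filter_upwards [(isOpen_lt continuous_norm continuous_const).mem_nhds hy] with z hz
    exact hh z hz
  have h1 : HasFDerivAt (fun z : EuclideanSpace ℝ (Fin N) => (r, r • z))
      ((0 : EuclideanSpace ℝ (Fin N) →L[ℝ] ℝ).prod
        (r • ContinuousLinearMap.id ℝ (EuclideanSpace ℝ (Fin N)))) y :=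
    (hasFDerivAt_const r y).prodMk ((hasFDerivAt_id y).const_smul r)
  have h2 := ((hf _ (mem_fcone r hr y hy)).hasFDerivAt.comp y h1).const_mul C
  have h3 : fderiv ℝ h y = _ := (h2.congr_of_eventuallyEq hev).fderiv
  unfold pd
  rw [h3]
  have h4 : ((0 : ℝ), r • EuclideanSpace.single i (1 : ℝ))
      = r • ((0 : ℝ), EuclideanSpace.single i (1 : ℝ)) := by simp
  simp only [ContinuousLinearMap.smul_apply, ContinuousLinearMap.comp_apply,
    ContinuousLinearMap.prod_apply, ContinuousLinearMap.zero_apply,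
    ContinuousLinearMap.id_apply, smul_eq_mul]
  rw [h4, map_smul]
  simp [mul_assoc]

theorem dT_scaled {N : ℕ} (f : ℝ × EuclideanSpace ℝ (Fin N) → ℝ)
    (h : ℝ → ℝ) (a c : ℝ)
    (hf : ∀ q ∈ fcone N, DifferentiableAt ℝ f q)
    (z : EuclideanSpace ℝ (Fin N)) (hz : ‖z‖ < 1)
    (hh : ∀ t : ℝ, h t = Real.exp (-(t - c)) ^ a
        * f (Real.exp (-(t - c)), Real.exp (-(t - c)) • z)) (s : ℝ) :
    deriv h s = Real.exp (-(s - c)) ^ a *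
      (-(a * f (Real.exp (-(s - c)), Real.exp (-(s - c)) • z)
        + fderiv ℝ f (Real.exp (-(s - c)), Real.exp (-(s - c)) • z)
          (Real.exp (-(s - c)), Real.exp (-(s - c)) • z))) := by
  have hfun : h = fun t => Real.exp (-(t - c)) ^ a
        * f (Real.exp (-(t - c)), Real.exp (-(t - c)) • z) := funext hh
  have he : HasDerivAt (fun t : ℝ => Real.exp (-(t - c))) (-Real.exp (-(s - c))) s := by
    have := (((hasDerivAt_id s).sub_const c).neg).exp
    simpa using this
  have hpos := Real.exp_pos (-(s - c))
  have h1 : HasDerivAt (fun t : ℝ => (Real.exp (-(t - c)), Real.exp (-(t - c)) • z))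
      (-Real.exp (-(s - c)), (-Real.exp (-(s - c))) • z) s := he.prodMk (he.smul_const z)
  have h2 := (hf _ (mem_fcone _ hpos z hz)).hasFDerivAt.comp_hasDerivAt s h1
  have h3 := (he.rpow_const (p := a) (Or.inl hpos.ne')).mul h2
  rw [hfun]
  refine h3.deriv.trans ?_
  have h4 : (-Real.exp (-(s - c)), (-Real.exp (-(s - c))) • z)
      = -(Real.exp (-(s - c)), Real.exp (-(s - c)) • z) := by simp
  rw [h4, map_neg, Real.rpow_sub_one hpos.ne']
  simp only [Function.comp]
  field_simp
  ring

theorem SSat_iff_WaveB {N : ℕ} (p : ℝ) (hp : 1 < p) (c : ℝ)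
    (u W : ℝ × EuclideanSpace ℝ (Fin N) → ℝ)
    (hu : ContDiffOn ℝ (⊤ : ℕ∞) u (fcone N))
    (hW : ∀ (t : ℝ) (z : EuclideanSpace ℝ (Fin N)), ‖z‖ < 1 →
      W (t, z) = Real.exp (-(t - c)) ^ (2 / (p - 1))
        * u (Real.exp (-(t - c)), Real.exp (-(t - c)) • z))
    (s : ℝ) (y : EuclideanSpace ℝ (Fin N)) (hy : ‖y‖ < 1) :
    SSat p W s y ↔ WaveB p u (Real.exp (-(s - c)), Real.exp (-(s - c)) • y) := by
  have hp1 : p - 1 ≠ 0 := by linarith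
  obtain ⟨a, ha⟩ : ∃ a, a = 2 / (p - 1) := ⟨_, rfl⟩
  have hpa : p = 1 + 2 / a := by rw [ha]; field_simp; ring
  have ha0 : 0 < a := by rw [ha]; exact div_pos two_pos (by linarith)
  rw [← ha] at hW
  have hu' : ContDiffOn ℝ (⊤ : ℕ∞) (fderiv ℝ u) (fcone N) :=
    hu.fderiv_of_isOpen (fcone_isOpen N) (by simp)
  have hud : ∀ q ∈ fcone N, DifferentiableAt ℝ u q := fun q hq =>
    ((hu.differentiableOn (by simp)) q hq).differentiableAt ((fcone_isOpen N).mem_nhds hq)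
  have hud' : ∀ q ∈ fcone N, DifferentiableAt ℝ (fderiv ℝ u) q := fun q hq =>
    ((hu'.differentiableOn (by simp)) q hq).differentiableAt ((fcone_isOpen N).mem_nhds hq)
  obtain ⟨g, hg⟩ : ∃ g : ℝ × EuclideanSpace ℝ (Fin N) → ℝ,
    g = fun q => -(a * u q + fderiv ℝ u q q) := ⟨_, rfl⟩
  have hgd : ∀ q ∈ fcone N, HasFDerivAt g (-(a • fderiv ℝ u q +
      ((fderiv ℝ u q).comp (ContinuousLinearMap.id ℝ _) + (fderiv ℝ (fderiv ℝ u) q).flip q))) q := by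
    intro q hq
    rw [hg]
    exact (((hud q hq).hasFDerivAt.const_mul a).add
      ((hud' q hq).hasFDerivAt.clm_apply (hasFDerivAt_id q))).neg
  have hdT : ∀ (t : ℝ) (z : EuclideanSpace ℝ (Fin N)), ‖z‖ < 1 →
      dT W t z = Real.exp (-(t - c)) ^ a
        * g (Real.exp (-(t - c)), Real.exp (-(t - c)) • z) := by
    intro t z hz
    rw [hg]
    exact dT_scaled u _ a c hud z hz (fun t' => hW t' z hz) t
  have hdTT := dT_scaled g (fun t => dT W t y) a c
    (fun q hq => (hgd q hq).differentiableAt) y hy (fun t => hdT t y hy) s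
  obtain ⟨r, hr⟩ : ∃ r, r = Real.exp (-(s - c)) := ⟨_, rfl⟩
  have hr0 : 0 < r := hr ▸ Real.exp_pos _
  have hmem := mem_fcone r hr0 y hy
  have hpdT : ∀ i, pd i (fun z => dT W s z) y = _ := fun i =>
    pd_scaled g (fun z => dT W s z) (r ^ a) r hr0 (fun q hq => (hgd q hq).differentiableAt)
      (fun z hz => by rw [hdT s z hz, hr]) i y hy
  have hpd : ∀ i, ∀ z : EuclideanSpace ℝ (Fin N), ‖z‖ < 1 → pd i (fun z => W (s, z)) z = _ :=
    fun i z hz => pd_scaled u (fun z => W (s, z)) (r ^ a) r hr0 hud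
      (fun z hz => by rw [hW s z hz, hr]) i z hz
  have hpdpd : ∀ i j, pd i (pd j (fun z => W (s, z))) y
      = r ^ a * r * r * fderiv ℝ (fderiv ℝ u) (r, r • y) (0, EuclideanSpace.single i 1)
        (0, EuclideanSpace.single j 1) := by
    intro i j
    have := pd_scaled (fun q => fderiv ℝ u q (0, EuclideanSpace.single j 1))
      (pd j (fun z => W (s, z))) (r ^ a * r) r hr0
      (fun q hq => (hud' q hq).clm_apply (differentiableAt_const _))
      (fun z hz => hpd j z hz) i y hy
    rw [this]
    congr 1
    have h5 := ((hud' _ hmem).hasFDerivAt.clm_apply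
      (hasFDerivAt_const ((0 : ℝ), EuclideanSpace.single j (1 : ℝ)) (r, r • y))).fderiv
    rw [h5]
    simp
  have hsymm : IsSymmSndFDerivAt ℝ u (r, r • y) := by
    refine ((hu _ hmem).contDiffAt ((fcone_isOpen N).mem_nhds hmem)).isSymmSndFDerivAt ?_
    rw [minSmoothness_of_isRCLikeNormedField]
    exact WithTop.coe_le_coe.2 (le_top : (2 : ℕ∞) ≤ ⊤)
  unfold SSat WaveB
  unfold dTT
  rw [hdTT, hdT s y hy, hW s y hy, ← hr]
  simp only [hpdT, hpdpd, hpd _ y hy]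
  rw [(hgd _ hmem).fderiv]
  set H := fderiv ℝ (fderiv ℝ u) (r, r • y) with hH
  set Lu := fderiv ℝ u (r, r • y) with hLu
  have e1 : ∑ i : Fin N, y i * (r ^ a * r * (-(a • Lu + (Lu.comp (ContinuousLinearMap.id ℝ _) + H.flip (r, r • y)))) (0, EuclideanSpace.single i 1))
      = r ^ a * r * (-(a • Lu + (Lu.comp (ContinuousLinearMap.id ℝ _) + H.flip (r, r • y)))) (0, y) := by
    rw [← lin_sum y, Finset.mul_sum]
    exact Finset.sum_congr rfl fun i _ => by ring
  have e2 : ∑ i : Fin N, y i * (r ^ a * r * Lu (0, EuclideanSpace.single i 1))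
      = r ^ a * r * Lu (0, y) := by
    rw [← lin_sum y, Finset.mul_sum]
    exact Finset.sum_congr rfl fun i _ => by ring
  have e3 : ∑ i : Fin N, ∑ j : Fin N, (y i * y j - if i = j then (1 : ℝ) else 0)
        * (r ^ a * r * r * H (0, EuclideanSpace.single i 1) (0, EuclideanSpace.single j 1))
      = r ^ a * r * r * (H (0, y) (0, y)
        - ∑ i : Fin N, H (0, EuclideanSpace.single i 1) (0, EuclideanSpace.single i 1)) := by
    have e4 : H (0, y) (0, y) = ∑ i : Fin N, ∑ j : Fin N,
        y i * y j * H (0, EuclideanSpace.single i 1) (0, EuclideanSpace.single j 1) := by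
      have := lin_sum y (H.flip (0, y))
      simp only [ContinuousLinearMap.flip_apply] at this
      rw [← this]
      refine Finset.sum_congr rfl fun i _ => ?_
      rw [← lin_sum y, Finset.mul_sum]
      exact Finset.sum_congr rfl fun i _ => by ring
    rw [e4, ← Finset.sum_sub_distrib, Finset.mul_sum]
    refine Finset.sum_congr rfl fun i _ => ?_
    simp only [sub_mul, ite_mul, one_mul, zero_mul, Finset.sum_sub_distrib,
      Finset.sum_ite_eq, Finset.mem_univ, if_true]
    rw [mul_sub, Finset.mul_sum]
    congr 1
    exact Finset.sum_congr rfl fun i _ => by ring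
  rw [e1, e2, e3]
  have hX : (r, r • y) = r • (((1 : ℝ), (0 : EuclideanSpace ℝ (Fin N))) + (0, y)) := by
    simp
  have hs : H (0, y) (1, 0) = H (1, 0) (0, y) := hsymm _ _
  have hgx : g (r, r • y) = -(a * u (r, r • y) + Lu (r, r • y)) := by rw [hg]
  rw [hgx]
  generalize u (r, r • y) = u0
  rw [hX]
  simp only [ContinuousLinearMap.neg_apply, ContinuousLinearMap.add_apply,
    ContinuousLinearMap.smul_apply, ContinuousLinearMap.comp_apply, ContinuousLinearMap.id_apply,
    ContinuousLinearMap.flip_apply, map_smul, map_add, smul_eq_mul, hs]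
  generalize ∑ i : Fin N, H (0, EuclideanSpace.single i 1) (0, EuclideanSpace.single i 1) = S
  have hra : 0 < r ^ a := Real.rpow_pos_of_pos hr0 a
  have habs : |r ^ a * u0| ^ (p - 1) = r * r * |u0| ^ (p - 1) := by
    rw [abs_mul, abs_of_pos hra, Real.mul_rpow hra.le (abs_nonneg _), ← Real.rpow_mul hr0.le]
    have : a * (p - 1) = 2 := by rw [ha]; field_simp
    rw [this, Real.rpow_two, sq]
  rw [habs]
  have c1 : (p + 3) / (p - 1) = 1 + 2 * a := by rw [ha]; field_simp; ring
  have c2 : 2 * (p + 1) / (p - 1) = 2 * (a + 1) := by rw [ha]; field_simp; ring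
  have c3 : 2 * (p + 1) / (p - 1) ^ 2 = a * (a + 1) := by rw [ha]; field_simp; ring
  rw [c1, c2, c3]
  have hne : r ^ a * r * r ≠ 0 := by positivity
  constructor
  · intro h
    apply mul_left_cancel₀ hne
    linear_combination h
  · intro h
    linear_combination (r ^ a * r * r) * h

/-- The boost as a continuous linear map. -/
def Lam {N : ℕ} (β : EuclideanSpace ℝ (Fin N)) (γ : ℝ) :
    (ℝ × EuclideanSpace ℝ (Fin N)) →L[ℝ] (ℝ × EuclideanSpace ℝ (Fin N)) :=
  (γ • (ContinuousLinearMap.fst ℝ ℝ (EuclideanSpace ℝ (Fin N))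
      - (innerSL ℝ β).comp (ContinuousLinearMap.snd ℝ ℝ (EuclideanSpace ℝ (Fin N))))).prod
    (ContinuousLinearMap.snd ℝ ℝ (EuclideanSpace ℝ (Fin N))
      - (γ • ContinuousLinearMap.fst ℝ ℝ (EuclideanSpace ℝ (Fin N))).smulRight β
      + ((γ ^ 2 / (1 + γ)) •
        (innerSL ℝ β).comp (ContinuousLinearMap.snd ℝ ℝ (EuclideanSpace ℝ (Fin N)))).smulRight β)

theorem Lam_apply {N : ℕ} (β : EuclideanSpace ℝ (Fin N)) (γ t : ℝ)
    (x : EuclideanSpace ℝ (Fin N)) :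
    Lam β γ (t, x) = (γ * (t - ⟪β, x⟫), x - (γ * t) • β + ((γ ^ 2 * ⟪β, x⟫) / (1 + γ)) • β) := by
  simp [Lam, div_mul_eq_mul_div]

theorem Lam_mem_fcone {N : ℕ} (β : EuclideanSpace ℝ (Fin N)) (γ : ℝ) (hβ : ‖β‖ < 1)
    (hγ : 0 < γ) (hγ2 : γ ^ 2 * (1 - ‖β‖ ^ 2) = 1)
    (q : ℝ × EuclideanSpace ℝ (Fin N)) (hq : q ∈ fcone N) : Lam β γ q ∈ fcone N := by
  obtain ⟨t, x⟩ := q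
  have hx : ‖x‖ < t := hq
  have ht : 0 < t := (norm_nonneg x).trans_lt hx
  have hin : ⟪β, x⟫ < t := by
    have h1 := real_inner_le_norm β x
    nlinarith [norm_nonneg x, norm_nonneg β]
  rw [Lam_apply]
  have hpos : 0 < γ * (t - ⟪β, x⟫) := mul_pos hγ (by linarith)
  show ‖_‖ < γ * (t - ⟪β, x⟫)
  refine lt_of_pow_lt_pow_left₀ 2 hpos.le ?_
  have hv : x - (γ * t) • β + ((γ ^ 2 * ⟪β, x⟫) / (1 + γ)) • β
      = x + ((γ ^ 2 * ⟪β, x⟫) / (1 + γ) - γ * t) • β := by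
    rw [sub_smul]; abel
  rw [hv, norm_add_sq_real, norm_smul, inner_smul_right, mul_pow, Real.norm_eq_abs, sq_abs,
    real_inner_comm β x]
  have hb : ‖β‖ ^ 2 = 1 - 1 / γ ^ 2 := by field_simp; linarith
  rw [hb]
  have key : ‖x‖ ^ 2 + 2 * (((γ ^ 2 * ⟪β, x⟫) / (1 + γ) - γ * t) * ⟪β, x⟫)
      + ((γ ^ 2 * ⟪β, x⟫) / (1 + γ) - γ * t) ^ 2 * (1 - 1 / γ ^ 2)
      = (γ * (t - ⟪β, x⟫)) ^ 2 - (t ^ 2 - ‖x‖ ^ 2) := by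
    field_simp
    ring
  rw [key]
  nlinarith [norm_nonneg x]

theorem WaveB_boost {N : ℕ} (p : ℝ) (β : EuclideanSpace ℝ (Fin N)) (γ : ℝ) (hβ : ‖β‖ < 1)
    (hγ : 0 < γ) (hγ2 : γ ^ 2 * (1 - ‖β‖ ^ 2) = 1)
    (u : ℝ × EuclideanSpace ℝ (Fin N) → ℝ)
    (hu : ContDiffOn ℝ (⊤ : ℕ∞) u (fcone N))
    (q : ℝ × EuclideanSpace ℝ (Fin N)) (hq : q ∈ fcone N)
    (h : WaveB p u (Lam β γ q)) : WaveB p (fun x => u (Lam β γ x)) q := by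
  have hu' : ContDiffOn ℝ (⊤ : ℕ∞) (fderiv ℝ u) (fcone N) :=
    hu.fderiv_of_isOpen (fcone_isOpen N) (by simp)
  have hud : ∀ q ∈ fcone N, DifferentiableAt ℝ u q := fun q hq =>
    ((hu.differentiableOn (by simp)) q hq).differentiableAt ((fcone_isOpen N).mem_nhds hq)
  have hud' : ∀ q ∈ fcone N, DifferentiableAt ℝ (fderiv ℝ u) q := fun q hq =>
    ((hu'.differentiableOn (by simp)) q hq).differentiableAt ((fcone_isOpen N).mem_nhds hq)
  have hL := Lam_mem_fcone β γ hβ hγ hγ2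
  have h1 : fderiv ℝ (fun x => u (Lam β γ x)) =ᶠ[nhds q]
      fun x => (fderiv ℝ u (Lam β γ x)).comp (Lam β γ) := by
    filter_upwards [(fcone_isOpen N).mem_nhds hq] with x hx
    exact ((hud _ (hL x hx)).hasFDerivAt.comp x (Lam β γ).hasFDerivAt).fderiv
  have h2 : HasFDerivAt (fun x => (fderiv ℝ u (Lam β γ x)).comp (Lam β γ)) _ q :=
    ((hud' _ (hL q hq)).hasFDerivAt.comp q (Lam β γ).hasFDerivAt).clm_comp
      (hasFDerivAt_const (Lam β γ) q)
  have h3 : ∀ v w, fderiv ℝ (fderiv ℝ (fun x => u (Lam β γ x))) q v w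
      = fderiv ℝ (fderiv ℝ u) (Lam β γ q) (Lam β γ v) (Lam β γ w) := by
    intro v w
    rw [(h2.congr_of_eventuallyEq h1).fderiv]
    simp
  have hmem := hL q hq
  have hsymm : IsSymmSndFDerivAt ℝ u (Lam β γ q) := by
    refine ((hu _ hmem).contDiffAt ((fcone_isOpen N).mem_nhds hmem)).isSymmSndFDerivAt ?_
    rw [minSmoothness_of_isRCLikeNormedField]
    exact WithTop.coe_le_coe.2 (le_top : (2 : ℕ∞) ≤ ⊤)
  unfold WaveB at h ⊢
  rw [← h]
  simp only [h3]
  unfold IsSymmSndFDerivAt at hsymm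
  generalize fderiv ℝ (fderiv ℝ u) (Lam β γ q) = H at hsymm
  have l0 : Lam β γ (1, 0) = γ • ((1 : ℝ), (0 : EuclideanSpace ℝ (Fin N))) - γ • ((0 : ℝ), β) := by
    rw [Lam_apply]; simp
  have li : ∀ i, Lam β γ (0, EuclideanSpace.single i 1)
      = (-(γ * β i)) • ((1 : ℝ), (0 : EuclideanSpace ℝ (Fin N)))
        + ((0 : ℝ), EuclideanSpace.single i 1) + (γ ^ 2 / (1 + γ) * β i) • ((0 : ℝ), β) := by
    intro i
    rw [Lam_apply]
    simp [EuclideanSpace.inner_single_right, div_mul_eq_mul_div]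
  simp only [l0, li]
  set k := γ ^ 2 / (1 + γ) with hk
  have hb : ‖β‖ ^ 2 = ∑ i, β i * β i := by
    rw [EuclideanSpace.norm_sq_eq]; simp [sq]
  have hterm : ∀ i : Fin N, H ((-(γ * β i)) • ((1 : ℝ), (0 : EuclideanSpace ℝ (Fin N)))
        + ((0 : ℝ), EuclideanSpace.single i 1) + (k * β i) • ((0 : ℝ), β))
        ((-(γ * β i)) • ((1 : ℝ), (0 : EuclideanSpace ℝ (Fin N)))
        + ((0 : ℝ), EuclideanSpace.single i 1) + (k * β i) • ((0 : ℝ), β))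
      = H (0, EuclideanSpace.single i 1) (0, EuclideanSpace.single i 1)
        + (γ ^ 2 * H (1, 0) (1, 0) + k ^ 2 * H (0, β) (0, β) - 2 * γ * k * H (1, 0) (0, β))
          * (β i * β i)
        + (-2 * γ) * (β i * H (1, 0) (0, EuclideanSpace.single i 1))
        + (2 * k) * (β i * H (0, β) (0, EuclideanSpace.single i 1)) := by
    intro i
    simp only [map_add, map_smul, ContinuousLinearMap.add_apply, ContinuousLinearMap.smul_apply,
      smul_eq_mul]
    rw [hsymm (0, β) (1, 0), hsymm (0, EuclideanSpace.single i 1) (1, 0),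
      hsymm (0, EuclideanSpace.single i 1) (0, β)]
    ring
  simp only [hterm, Finset.sum_add_distrib, ← Finset.mul_sum, lin_sum, ← hb]
  simp only [map_sub, map_smul, ContinuousLinearMap.sub_apply, ContinuousLinearMap.smul_apply,
      smul_eq_mul]
  rw [hsymm (0, β) (1, 0)]
  have hkb : k * ‖β‖ ^ 2 = γ - 1 := by
    have : ‖β‖ ^ 2 = 1 - 1 / γ ^ 2 := by field_simp; linarith
    rw [this, hk]; field_simp; ring
  have hk1 : k * (1 + γ) = γ ^ 2 := by rw [hk]; field_simp
  linear_combination H (1, 0) (1, 0) * hγ2 + (2 * γ * H (1, 0) (0, β) - k * H (0, β) (0, β)) * hkb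
    - H (0, β) (0, β) * hk1

/-- Lorentz transform in self-similar variables: if `U` is a smooth solution of the
self-similar wave equation on `ℝ × {|y| < 1}` and `|β| < 1`, then `𝒯_β U` is well
defined and is a smooth solution of the self-similar wave equation on `ℝ × {|y'| < 1}`. -/
theorem lorentz_selfsimilar_transform (N : ℕ) (hN : 1 ≤ N) (p : ℝ) (hp : 1 < p)
    (β : EuclideanSpace ℝ (Fin N)) (hβ : ‖β‖ < 1)
    (U : ℝ × EuclideanSpace ℝ (Fin N) → ℝ)
    (hsmooth : ContDiffOn ℝ (⊤ : ℕ∞) U {q : ℝ × EuclideanSpace ℝ (Fin N) | ‖q.2‖ < 1})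
    (hsol : ∀ (s : ℝ) (y : EuclideanSpace ℝ (Fin N)), ‖y‖ < 1 → SSat p U s y) :
    (∀ y' : EuclideanSpace ℝ (Fin N), ‖y'‖ < 1 →
        0 < 1 - ⟪β, y'⟫ ∧ ‖ymap β y'‖ < 1) ∧
    ContDiffOn ℝ (⊤ : ℕ∞) (lorentzSS p β U)
      {q : ℝ × EuclideanSpace ℝ (Fin N) | ‖q.2‖ < 1} ∧
    ∀ (s' : ℝ) (y' : EuclideanSpace ℝ (Fin N)), ‖y'‖ < 1 →
      SSat p (lorentzSS p β U) s' y' := by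
  obtain ⟨γ, hγdef⟩ : ∃ γ, γ = (1 - ‖β‖ ^ 2) ^ (-(1 / 2) : ℝ) := ⟨_, rfl⟩
  have hb : 0 < 1 - ‖β‖ ^ 2 := by nlinarith [norm_nonneg β]
  have hγ : 0 < γ := hγdef ▸ Real.rpow_pos_of_pos hb _
  have hγ2 : γ ^ 2 * (1 - ‖β‖ ^ 2) = 1 := by
    rw [hγdef, ← Real.rpow_natCast, ← Real.rpow_mul hb.le]
    norm_num
    rw [Real.rpow_neg_one]
    exact inv_mul_cancel₀ hb.ne'
  have hL := Lam_mem_fcone β γ hβ hγ hγ2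
  have hym : ∀ y' : EuclideanSpace ℝ (Fin N),
      ymap β y' = (Lam β γ (1, y')).1⁻¹ • (Lam β γ (1, y')).2 := by
    intro y'
    rw [Lam_apply, hγdef]
    simp [ymap]
  have hA : ∀ y' : EuclideanSpace ℝ (Fin N), ‖y'‖ < 1 →
        0 < 1 - ⟪β, y'⟫ ∧ ‖ymap β y'‖ < 1 := by
    intro y' hy'
    have h1 : ‖(Lam β γ (1, y')).2‖ < (Lam β γ (1, y')).1 := hL (1, y') hy'
    have h2 : 0 < (Lam β γ (1, y')).1 := (norm_nonneg _).trans_lt h1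
    constructor
    · rw [Lam_apply] at h2
      exact (mul_pos_iff_of_pos_left hγ).1 h2
    · rw [hym, norm_smul, norm_inv, Real.norm_eq_abs, abs_of_pos h2, inv_mul_lt_one₀ h2]
      exact h1
  obtain ⟨u, hu⟩ : ∃ u : ℝ × EuclideanSpace ℝ (Fin N) → ℝ,
    u = fun q => q.1 ^ (-(2 / (p - 1))) * U (Real.log γ - Real.log q.1, q.1⁻¹ • q.2) := ⟨_, rfl⟩
  have hus : ContDiffOn ℝ (⊤ : ℕ∞) u (fcone N) := by
    have hpos : ∀ q ∈ fcone N, q.1 ≠ 0 := fun q hq => ((norm_nonneg _).trans_lt hq).ne'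
    have hlog : ContDiffOn ℝ (⊤ : ℕ∞)
        (fun q : ℝ × EuclideanSpace ℝ (Fin N) => Real.log q.1) (fcone N) :=
      contDiff_fst.contDiffOn.log hpos
    have hinv : ContDiffOn ℝ (⊤ : ℕ∞)
        (fun q : ℝ × EuclideanSpace ℝ (Fin N) => q.1⁻¹) (fcone N) :=
      contDiff_fst.contDiffOn.inv hpos
    rw [hu]
    refine (contDiff_fst.contDiffOn.rpow_const_of_ne hpos).mul
      (hsmooth.comp ((contDiffOn_const.sub hlog).prodMk (hinv.smul contDiff_snd.contDiffOn)) ?_)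
    intro q hq
    have h1 : ‖q.2‖ < q.1 := hq
    have h2 : 0 < q.1 := (norm_nonneg _).trans_lt h1
    show ‖q.1⁻¹ • q.2‖ < 1
    rw [norm_smul, norm_inv, Real.norm_eq_abs, abs_of_pos h2, inv_mul_lt_one₀ h2]
    exact h1
  have hUW : ∀ (t : ℝ) (z : EuclideanSpace ℝ (Fin N)), ‖z‖ < 1 →
      U (t, z) = Real.exp (-(t - Real.log γ)) ^ (2 / (p - 1))
        * u (Real.exp (-(t - Real.log γ)), Real.exp (-(t - Real.log γ)) • z) := by
    intro t z _
    have he := Real.exp_pos (-(t - Real.log γ))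
    simp only [hu]
    rw [← mul_assoc, ← Real.rpow_add he, smul_smul, inv_mul_cancel₀ he.ne', Real.log_exp]
    simp
  have hwave : ∀ q ∈ fcone N, WaveB p u q := by
    intro q hq
    have h1 : ‖q.2‖ < q.1 := hq
    have h2 : 0 < q.1 := (norm_nonneg _).trans_lt h1
    have h3 : ‖q.1⁻¹ • q.2‖ < 1 := by
      rw [norm_smul, norm_inv, Real.norm_eq_abs, abs_of_pos h2, inv_mul_lt_one₀ h2]
      exact h1
    have h4 := (SSat_iff_WaveB p hp (Real.log γ) u U hus hUW (Real.log γ - Real.log q.1)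
      (q.1⁻¹ • q.2) h3).1 (hsol _ _ h3)
    have h5 : Real.exp (-(Real.log γ - Real.log q.1 - Real.log γ)) = q.1 := by
      rw [show -(Real.log γ - Real.log q.1 - Real.log γ) = Real.log q.1 by ring, Real.exp_log h2]
    rw [h5, smul_smul, mul_inv_cancel₀ h2.ne', one_smul] at h4
    exact h4
  have hvs : ContDiffOn ℝ (⊤ : ℕ∞) (fun x => u (Lam β γ x)) (fcone N) :=
    hus.comp (Lam β γ).contDiff.contDiffOn hL
  have hVW : ∀ (t : ℝ) (z : EuclideanSpace ℝ (Fin N)), ‖z‖ < 1 →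
      lorentzSS p β U (t, z) = Real.exp (-(t - 0)) ^ (2 / (p - 1))
        * u (Lam β γ (Real.exp (-(t - 0)), Real.exp (-(t - 0)) • z)) := by
    intro t z hz
    have he := Real.exp_pos (-(t - 0))
    have h1 := (hA z hz).1
    have hlin : ((Real.exp (-(t - 0)), Real.exp (-(t - 0)) • z) :
        ℝ × EuclideanSpace ℝ (Fin N)) = Real.exp (-(t - 0)) • ((1 : ℝ), z) := by simp
    have hlog : Real.log γ - Real.log (Real.exp (-(t - 0)) * (γ * (1 - ⟪β, z⟫)))
        = t - Real.log (1 - ⟪β, z⟫) := by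
      rw [Real.log_mul he.ne' (by positivity), Real.log_mul hγ.ne' h1.ne', Real.log_exp]
      ring
    have hfst : (Lam β γ (1, z)).1 = γ * (1 - ⟪β, z⟫) := by rw [Lam_apply]
    rw [hlin, map_smul, hu]
    simp only [Prod.smul_fst, Prod.smul_snd, smul_eq_mul, lorentzSS, hym, smul_smul]
    rw [hfst, hlog, ← hγdef, Real.mul_rpow he.le (by positivity), ← mul_assoc, ← mul_assoc,
      ← Real.rpow_add he]
    have h6 : (Real.exp (-(t - 0)) * (γ * (1 - ⟪β, z⟫)))⁻¹ * Real.exp (-(t - 0))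
        = (γ * (1 - ⟪β, z⟫))⁻¹ := by field_simp
    rw [h6]
    simp
  refine ⟨hA, ?_, ?_⟩
  · have hexp : ContDiff ℝ (⊤ : ℕ∞)
        (fun q : ℝ × EuclideanSpace ℝ (Fin N) => Real.exp (-(q.1 - 0))) :=
      ((contDiff_fst.sub contDiff_const).neg).exp
    have hcomp : ContDiffOn ℝ (⊤ : ℕ∞)
        (fun q : ℝ × EuclideanSpace ℝ (Fin N) => Real.exp (-(q.1 - 0)) ^ (2 / (p - 1))
        * u (Lam β γ (Real.exp (-(q.1 - 0)), Real.exp (-(q.1 - 0)) • q.2)))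
        {q : ℝ × EuclideanSpace ℝ (Fin N) | ‖q.2‖ < 1} := by
      refine (hexp.rpow_const_of_ne fun q => (Real.exp_pos _).ne').contDiffOn.mul
        (hvs.comp (hexp.prodMk (hexp.smul contDiff_snd)).contDiffOn ?_)
      intro q hq
      exact mem_fcone _ (Real.exp_pos _) q.2 hq
    exact hcomp.congr fun q hq => hVW q.1 q.2 hq
  · intro s' y' hy'
    refine (SSat_iff_WaveB p hp 0 (fun x => u (Lam β γ x)) _ hvs hVW s' y' hy').2 ?_
    have hm := mem_fcone (Real.exp (-(s' - 0))) (Real.exp_pos _) y' hy'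
    exact WaveB_boost p β γ hβ hγ hγ2 u hus _ hm (hwave _ (hL _ hm))

end
end

section
/- Fix an integer N ≥ 1 and a real number p > 1, and let d ∈ ℝ^N with |d| < 1. If η is a smooth solution of the linearized self-similar equation around κ_d on ℝ × {|y| < 1}, then ξ := 𝒯_d η is a smooth solution of the linearized self-similar equation around κ₀ on ℝ × {|y'| < 1}, i.e. ξ satisfies the same equation with the potential p κ_d(y)^{p−1} replaced by the constant p κ₀^{p−1} = 2p(p+1)/(p−1)². -/
open scoped RealInnerProductSpace

noncomputable section

section LorentzAux

variable {N : ℕ}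

/-- The second order operator of the linearized equation, in coordinate-free form. -/
def Pop (a : ℝ) (F : ℝ × EuclideanSpace ℝ (Fin N) → ℝ)
    (q : ℝ × EuclideanSpace ℝ (Fin N)) : ℝ :=
  fderiv ℝ (fderiv ℝ F) q (1, q.2) (1, q.2)
    - (∑ i : Fin N, fderiv ℝ (fderiv ℝ F) q (0, EuclideanSpace.single i 1)
        (0, EuclideanSpace.single i 1))
    + (2 * a + 1) * fderiv ℝ F q (1, 0) + (2 * a + 2) * fderiv ℝ F q (0, q.2)
    + a * (a + 1) * F q

/-- The d'Alembertian. -/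
def boxOp (G : ℝ × EuclideanSpace ℝ (Fin N) → ℝ)
    (q : ℝ × EuclideanSpace ℝ (Fin N)) : ℝ :=
  fderiv ℝ (fderiv ℝ G) q (1, 0) (1, 0)
    - (∑ i : Fin N, fderiv ℝ (fderiv ℝ G) q (0, EuclideanSpace.single i 1)
        (0, EuclideanSpace.single i 1))

/-- Passage from self-similar to physical variables. -/
def Wf (a c : ℝ) (F : ℝ × EuclideanSpace ℝ (Fin N) → ℝ)
    (q : ℝ × EuclideanSpace ℝ (Fin N)) : ℝ :=
  q.1 ^ (-a) * F (c - Real.log q.1, q.1⁻¹ • q.2)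

/-- The Lorentz boost as a continuous linear map. -/
def boostL (g : ℝ) (d : EuclideanSpace ℝ (Fin N)) :
    (ℝ × EuclideanSpace ℝ (Fin N)) →L[ℝ] (ℝ × EuclideanSpace ℝ (Fin N)) :=
  (g • (ContinuousLinearMap.fst ℝ ℝ (EuclideanSpace ℝ (Fin N))
      - (innerSL ℝ d).comp (ContinuousLinearMap.snd ℝ ℝ (EuclideanSpace ℝ (Fin N))))).prod
  (ContinuousLinearMap.snd ℝ ℝ (EuclideanSpace ℝ (Fin N))
    - (g • ContinuousLinearMap.fst ℝ ℝ (EuclideanSpace ℝ (Fin N))).smulRight d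
    + ((g ^ 2 / (1 + g)) • (innerSL ℝ d).comp
        (ContinuousLinearMap.snd ℝ ℝ (EuclideanSpace ℝ (Fin N)))).smulRight d)

lemma boostL_apply (g : ℝ) (d : EuclideanSpace ℝ (Fin N)) (t : ℝ)
    (x : EuclideanSpace ℝ (Fin N)) :
    boostL g d (t, x) = (g * (t - ⟪d, x⟫),
      x - (g * t) • d + (g ^ 2 / (1 + g) * ⟪d, x⟫) • d) := by
  simp [boostL]

lemma fderiv_fderiv_apply {V : Type*} [NormedAddCommGroup V] [NormedSpace ℝ V]
    {F : V → ℝ} {q : V} (hF : ContDiffAt ℝ 2 F q) (v w : V) :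
    fderiv ℝ (fun z => fderiv ℝ F z v) q w = fderiv ℝ (fderiv ℝ F) q w v := by
  have h : DifferentiableAt ℝ (fderiv ℝ F) q :=
    (hF.fderiv_right (m := 1) (by norm_num)).differentiableAt (by norm_num)
  rw [fderiv_clm_apply h (differentiableAt_const v)]
  simp

lemma fderiv_symm {V : Type*} [NormedAddCommGroup V] [NormedSpace ℝ V]
    {F : V → ℝ} {q : V} (hF : ContDiffAt ℝ 2 F q) (v w : V) :
    fderiv ℝ (fderiv ℝ F) q w v = fderiv ℝ (fderiv ℝ F) q v w := by
  exact hF.isSymmSndFDerivAt (by simp) w v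

lemma dT_eq {F : ℝ × EuclideanSpace ℝ (Fin N) → ℝ} {s : ℝ} {y : EuclideanSpace ℝ (Fin N)}
    (hF : DifferentiableAt ℝ F (s, y)) : dT F s y = fderiv ℝ F (s, y) (1, 0) := by
  have h : HasDerivAt (fun t : ℝ => (t, y)) ((1 : ℝ), (0 : EuclideanSpace ℝ (Fin N))) s :=
    (hasDerivAt_id s).prodMk (hasDerivAt_const s y)
  exact (hF.hasFDerivAt.comp_hasDerivAt s h).deriv

lemma pd_eq {F : ℝ × EuclideanSpace ℝ (Fin N) → ℝ} {s : ℝ} {y : EuclideanSpace ℝ (Fin N)}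
    (hF : DifferentiableAt ℝ F (s, y)) (i : Fin N) :
    pd i (fun z => F (s, z)) y = fderiv ℝ F (s, y) (0, EuclideanSpace.single i 1) := by
  have h : HasFDerivAt (fun z : EuclideanSpace ℝ (Fin N) => (s, z))
      ((0 : EuclideanSpace ℝ (Fin N) →L[ℝ] ℝ).prod (ContinuousLinearMap.id ℝ _)) y :=
    (hasFDerivAt_const s y).prodMk (hasFDerivAt_id y)
  have := (hF.hasFDerivAt.comp y h).fderiv
  unfold pd
  erw [this]
  simp

lemma linEqAt_iff {p : ℝ} (hp : 1 < p) {V : EuclideanSpace ℝ (Fin N) → ℝ}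
    {F : ℝ × EuclideanSpace ℝ (Fin N) → ℝ} {s : ℝ} {y : EuclideanSpace ℝ (Fin N)}
    (hF : ContDiffAt ℝ 2 F (s, y)) :
    LinEqAt p V F s y ↔ Pop (2 / (p - 1)) F (s, y) = V y * F (s, y) := by
  have hev : ∀ᶠ q in nhds (s, y), DifferentiableAt ℝ F q := by
    filter_upwards [hF.eventually (by simp)] with q hq
    exact hq.differentiableAt (by norm_num)
  have hD : DifferentiableAt ℝ (fderiv ℝ F) (s, y) :=
    (hF.fderiv_right (m := 1) (by norm_num)).differentiableAt (by norm_num)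
  have hDv : ∀ v, DifferentiableAt ℝ (fun q => fderiv ℝ F q v) (s, y) := fun v =>
    hD.clm_apply (differentiableAt_const v)
  have c1 : Filter.Tendsto (fun t : ℝ => (t, y)) (nhds s) (nhds (s, y)) :=
    (by fun_prop : Continuous (fun t : ℝ => (t, y))).tendsto s
  have c2 : Filter.Tendsto (fun z : EuclideanSpace ℝ (Fin N) => (s, z)) (nhds y)
      (nhds (s, y)) :=
    (by fun_prop : Continuous (fun z : EuclideanSpace ℝ (Fin N) => (s, z))).tendsto y
  have e1 : dT F s y = fderiv ℝ F (s, y) (1, 0) := dT_eq hev.self_of_nhds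
  have e2 : dTT F s y = fderiv ℝ (fderiv ℝ F) (s, y) (1, 0) (1, 0) := by
    unfold dTT
    rw [← fderiv_fderiv_apply hF, ← dT_eq (hDv _)]
    apply Filter.EventuallyEq.deriv_eq
    filter_upwards [c1.eventually hev] with t ht
    exact dT_eq ht
  have e3 : ∀ i, pd i (fun z => dT F s z) y
      = fderiv ℝ (fderiv ℝ F) (s, y) (0, EuclideanSpace.single i 1) (1, 0) := by
    intro i
    rw [← fderiv_fderiv_apply hF, ← pd_eq (hDv _)]
    unfold pd
    congr 1
    apply Filter.EventuallyEq.fderiv_eq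
    filter_upwards [c2.eventually hev] with t ht
    exact dT_eq ht
  have e4 : ∀ i, pd i (fun z => F (s, z)) y
      = fderiv ℝ F (s, y) (0, EuclideanSpace.single i 1) :=
    fun i => pd_eq hev.self_of_nhds i
  have e5 : ∀ i j, pd i (pd j (fun z => F (s, z))) y
      = fderiv ℝ (fderiv ℝ F) (s, y) (0, EuclideanSpace.single i 1)
        (0, EuclideanSpace.single j 1) := by
    intro i j
    rw [← fderiv_fderiv_apply hF, ← pd_eq (hDv _)]
    unfold pd
    congr 1
    apply Filter.EventuallyEq.fderiv_eq
    filter_upwards [c2.eventually hev] with t ht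
    exact pd_eq ht j
  have hy : ((0 : ℝ), y) = ∑ i, y i • ((0 : ℝ), EuclideanSpace.single i (1 : ℝ)) := by
    ext i
    · simp [Prod.fst_sum]
    · simp [Prod.snd_sum, Pi.single_apply]
  have l1 : fderiv ℝ F (s, y) (0, y)
      = ∑ i, y i * fderiv ℝ F (s, y) (0, EuclideanSpace.single i 1) := by
    conv_lhs => rw [hy]
    simp only [map_sum, sum_apply, map_smul, smul_apply, smul_eq_mul]
  have l2 : fderiv ℝ (fderiv ℝ F) (s, y) (0, y) (1, 0)
      = ∑ i, y i * fderiv ℝ (fderiv ℝ F) (s, y) (0, EuclideanSpace.single i 1) (1, 0) := by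
    conv_lhs => rw [hy]
    simp only [map_sum, sum_apply, map_smul, smul_apply, smul_eq_mul]
  have l3 : fderiv ℝ (fderiv ℝ F) (s, y) (0, y) (0, y)
      = ∑ i, ∑ j, y i * y j * fderiv ℝ (fderiv ℝ F) (s, y) (0, EuclideanSpace.single i 1)
        (0, EuclideanSpace.single j 1) := by
    conv_lhs => rw [hy]
    simp only [map_sum, sum_apply, map_smul,
      smul_apply, smul_eq_mul, Finset.mul_sum]
    rw [Finset.sum_comm]
    refine Finset.sum_congr rfl fun i _ => Finset.sum_congr rfl fun j _ => by ring
  have l4 : fderiv ℝ (fderiv ℝ F) (s, y) (1, y) (1, y)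
      = fderiv ℝ (fderiv ℝ F) (s, y) (1, 0) (1, 0)
        + 2 * fderiv ℝ (fderiv ℝ F) (s, y) (0, y) (1, 0)
        + fderiv ℝ (fderiv ℝ F) (s, y) (0, y) (0, y) := by
    have : ((1 : ℝ), y) = (1, 0) + (0, y) := by simp
    rw [this]
    simp only [map_add, add_apply]
    rw [fderiv_symm hF (0, y) (1, 0)]
    ring
  have l5 : (∑ i : Fin N, ∑ j : Fin N, (y i * y j - if i = j then (1 : ℝ) else 0)
        * fderiv ℝ (fderiv ℝ F) (s, y) (0, EuclideanSpace.single i 1)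
        (0, EuclideanSpace.single j 1))
      = fderiv ℝ (fderiv ℝ F) (s, y) (0, y) (0, y)
        - ∑ i : Fin N, fderiv ℝ (fderiv ℝ F) (s, y) (0, EuclideanSpace.single i 1)
        (0, EuclideanSpace.single i 1) := by
    rw [l3, ← Finset.sum_sub_distrib]
    refine Finset.sum_congr rfl fun i _ => ?_
    simp [sub_mul, Finset.sum_sub_distrib]
  unfold LinEqAt Pop
  simp only [e1, e2, e3, e4, e5]
  rw [l5, ← l1, ← l2]
  simp only [l4]
  have hp' : p - 1 ≠ 0 := by linarith
  have k1 : 2 * (2 / (p - 1)) + 1 = (p + 3) / (p - 1) := by field_simp; ring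
  have k2 : 2 * (2 / (p - 1)) + 2 = 2 * (p + 1) / (p - 1) := by field_simp; ring
  have k3 : 2 / (p - 1) * (2 / (p - 1) + 1) = 2 * (p + 1) / (p - 1) ^ 2 := by
    field_simp; ring
  rw [k1, k2, k3, ← sub_eq_zero (b := V y * F (s, y))]
  constructor <;> intro h <;> linear_combination h

lemma hasFDerivAt_Wf {a c : ℝ} {F : ℝ × EuclideanSpace ℝ (Fin N) → ℝ} {t : ℝ}
    {x : EuclideanSpace ℝ (Fin N)} (ht : 0 < t)
    (hF : DifferentiableAt ℝ F (c - Real.log t, t⁻¹ • x)) :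
    fderiv ℝ (Wf a c F) (t, x) (1, 0)
      = - Wf (a + 1) c (fun q => a * F q + fderiv ℝ F q (1, q.2)) (t, x) ∧
    ∀ v, fderiv ℝ (Wf a c F) (t, x) (0, v)
      = Wf (a + 1) c (fun q => fderiv ℝ F q (0, v)) (t, x) := by
  have f1 : HasFDerivAt (fun q : ℝ × EuclideanSpace ℝ (Fin N) => q.1)
    (ContinuousLinearMap.fst ℝ ℝ _) (t, x) := hasFDerivAt_fst
  have f2 : HasFDerivAt (fun q : ℝ × EuclideanSpace ℝ (Fin N) => q.2)
    (ContinuousLinearMap.snd ℝ ℝ _) (t, x) := hasFDerivAt_snd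
  have g1 := (Real.hasDerivAt_rpow_const (x := t) (p := -a) (Or.inl ht.ne')).comp_hasFDerivAt
    (t, x) f1
  have g2 := ((Real.hasDerivAt_log ht.ne').comp_hasFDerivAt (t, x) f1).const_sub c
  have g3 := ((hasDerivAt_inv ht.ne').comp_hasFDerivAt (t, x) f1).smul f2
  have g4 := hF.hasFDerivAt.comp (t, x) (g2.prodMk g3)
  have g5 : HasFDerivAt (Wf a c F) _ (t, x) := g1.mul g4
  have r1 : t ^ (-a - 1) = t ^ (-a) * t⁻¹ := by
    rw [Real.rpow_sub ht, Real.rpow_one]; rfl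
  have r2 : t ^ (-(a + 1)) = t ^ (-a) * t⁻¹ := by rw [← r1]; congr 1; ring
  rw [g5.fderiv]
  have e : ((-t⁻¹ : ℝ), -((t ^ 2)⁻¹ • x)) = (-t⁻¹) • ((1 : ℝ), t⁻¹ • x) := by
    rw [Prod.smul_mk, smul_smul, ← neg_smul]
    congr 1
    · simp
    · congr 1; field_simp
  constructor
  · simp only [Wf, Function.comp, r2, r1]
    simp [-Prod.smul_mk, -Prod.neg_mk]
    rw [e, map_smul, smul_eq_mul]
    ring
  · intro v
    have e2 : ((0 : ℝ), t⁻¹ • v) = t⁻¹ • ((0 : ℝ), v) := by simp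
    simp only [Wf, Function.comp, r2]
    simp [e2, -Prod.smul_mk]
    ring

lemma boxOp_Wf {a c : ℝ} {F : ℝ × EuclideanSpace ℝ (Fin N) → ℝ} {t : ℝ}
    {x : EuclideanSpace ℝ (Fin N)} (ht : 0 < t)
    (hF : ContDiffAt ℝ 2 F (c - Real.log t, t⁻¹ • x)) :
    ContDiffAt ℝ 2 (Wf a c F) (t, x) ∧
    boxOp (Wf a c F) (t, x)
      = t ^ (-a) * (t ^ 2)⁻¹ * Pop a F (c - Real.log t, t⁻¹ • x) := by
  have ht' : (t, x).1 ≠ 0 := ht.ne'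
  have hinner : ContDiffAt ℝ 2 (fun q : ℝ × EuclideanSpace ℝ (Fin N) =>
      (c - Real.log q.1, q.1⁻¹ • q.2)) (t, x) := by
    have := contDiffAt_fst (𝕜 := ℝ) (n := 2) (p := (t, x))
    have h2 := contDiffAt_snd (𝕜 := ℝ) (n := 2) (p := (t, x))
    exact (contDiffAt_const.sub (this.log ht')).prodMk ((this.inv ht').smul h2)
  have hW : ContDiffAt ℝ 2 (Wf a c F) (t, x) := by
    unfold Wf
    refine (contDiffAt_fst.rpow_const_of_ne ht').mul ?_
    exact ContDiffAt.comp (g := F) (t, x) hF hinner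
  refine ⟨hW, ?_⟩
  have hev0 : ∀ᶠ q in nhds (c - Real.log t, t⁻¹ • x), DifferentiableAt ℝ F q := by
    filter_upwards [hF.eventually (by simp)] with q hq
    exact hq.differentiableAt (by norm_num)
  have hev : ∀ᶠ q in nhds (t, x), DifferentiableAt ℝ F (c - Real.log q.1, q.1⁻¹ • q.2) :=
    hinner.continuousAt.tendsto.eventually hev0
  have hpos : ∀ᶠ q : ℝ × EuclideanSpace ℝ (Fin N) in nhds (t, x), 0 < q.1 :=
    continuousAt_fst.eventually (lt_mem_nhds ht)
  have hD : DifferentiableAt ℝ (fderiv ℝ F) (c - Real.log t, t⁻¹ • x) :=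
    (hF.fderiv_right (m := 1) (by norm_num)).differentiableAt (by norm_num)
  have hFd := hev0.self_of_nhds
  have r2 : t ^ (-(a + 1 + 1)) = t ^ (-a) * (t ^ 2)⁻¹ := by
    rw [show -(a + 1 + 1) = -a - 2 by ring, Real.rpow_sub ht]
    norm_cast
  have hxx : ∀ v, fderiv ℝ (fderiv ℝ (Wf a c F)) (t, x) (0, v) (0, v)
      = t ^ (-a) * (t ^ 2)⁻¹
        * fderiv ℝ (fderiv ℝ F) (c - Real.log t, t⁻¹ • x) (0, v) (0, v) := by
    intro v
    rw [← fderiv_fderiv_apply hW]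
    have : (fun z => fderiv ℝ (Wf a c F) z (0, v)) =ᶠ[nhds (t, x)]
        Wf (a + 1) c (fun q => fderiv ℝ F q (0, v)) := by
      filter_upwards [hev, hpos] with q h1 h2
      exact (hasFDerivAt_Wf h2 h1).2 v
    rw [this.fderiv_eq, (hasFDerivAt_Wf ht (hD.clm_apply (differentiableAt_const _))).2 v]
    simp only [Wf]
    rw [fderiv_fderiv_apply hF, r2]
  have hG : HasFDerivAt (fun q : ℝ × EuclideanSpace ℝ (Fin N) =>
      a * F q + fderiv ℝ F q (1, q.2)) _ (c - Real.log t, t⁻¹ • x) :=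
    (hFd.hasFDerivAt.const_mul a).add
      (hD.hasFDerivAt.clm_apply ((hasFDerivAt_const (1 : ℝ) _).prodMk hasFDerivAt_snd))
  have htt : fderiv ℝ (fderiv ℝ (Wf a c F)) (t, x) (1, 0) (1, 0)
      = t ^ (-a) * (t ^ 2)⁻¹ * ((a + 1) * (a * F (c - Real.log t, t⁻¹ • x)
          + fderiv ℝ F (c - Real.log t, t⁻¹ • x) (1, t⁻¹ • x))
        + (a * fderiv ℝ F (c - Real.log t, t⁻¹ • x) (1, t⁻¹ • x)
          + fderiv ℝ F (c - Real.log t, t⁻¹ • x) (0, t⁻¹ • x)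
          + fderiv ℝ (fderiv ℝ F) (c - Real.log t, t⁻¹ • x) (1, t⁻¹ • x) (1, t⁻¹ • x))) := by
    rw [← fderiv_fderiv_apply hW]
    have : (fun z => fderiv ℝ (Wf a c F) z (1, 0)) =ᶠ[nhds (t, x)]
        fun z => - Wf (a + 1) c (fun q => a * F q + fderiv ℝ F q (1, q.2)) z := by
      filter_upwards [hev, hpos] with q h1 h2
      exact (hasFDerivAt_Wf h2 h1).1
    rw [this.fderiv_eq, fderiv_fun_neg, neg_apply,
      (hasFDerivAt_Wf ht hG.differentiableAt).1]
    simp only [Wf]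
    rw [hG.fderiv, r2]
    simp only [add_apply, smul_apply, ContinuousLinearMap.comp_apply,
      ContinuousLinearMap.prod_apply, zero_apply, ContinuousLinearMap.flip_apply,
      smul_eq_mul, ContinuousLinearMap.coe_snd']
    ring
  have l1 : fderiv ℝ F (c - Real.log t, t⁻¹ • x) (1, t⁻¹ • x)
      = fderiv ℝ F (c - Real.log t, t⁻¹ • x) (1, 0)
        + fderiv ℝ F (c - Real.log t, t⁻¹ • x) (0, t⁻¹ • x) := by
    rw [← map_add]; simp
  unfold boxOp Pop
  simp only [hxx, htt, ← Finset.mul_sum, l1]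
  ring

lemma boxOp_boost {g : ℝ} {d : EuclideanSpace ℝ (Fin N)} (hg : 0 < g)
    (hgd : g ^ 2 * (1 - ‖d‖ ^ 2) = 1)
    {G : ℝ × EuclideanSpace ℝ (Fin N) → ℝ} {q : ℝ × EuclideanSpace ℝ (Fin N)}
    (hG : ContDiffAt ℝ 2 G (boostL g d q)) :
    boxOp (fun z => G (boostL g d z)) q = boxOp G (boostL g d q) := by
  have hC : ContDiffAt ℝ 2 (fun z => G (boostL g d z)) q :=
    ContDiffAt.comp (g := G) q hG (boostL g d).contDiff.contDiffAt
  have hev : ∀ᶠ z in nhds q, DifferentiableAt ℝ G (boostL g d z) := by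
    apply (boostL g d).continuous.continuousAt.eventually
    filter_upwards [hG.eventually (by simp)] with q hq
    exact hq.differentiableAt (by norm_num)
  have hD : DifferentiableAt ℝ (fderiv ℝ G) (boostL g d q) :=
    (hG.fderiv_right (m := 1) (by norm_num)).differentiableAt (by norm_num)
  have key : ∀ v w, fderiv ℝ (fderiv ℝ (fun z => G (boostL g d z))) q v w
      = fderiv ℝ (fderiv ℝ G) (boostL g d q) (boostL g d v) (boostL g d w) := by
    intro v w
    rw [← fderiv_fderiv_apply hC, ← fderiv_fderiv_apply hG]
    have : (fun z => fderiv ℝ (fun z => G (boostL g d z)) z w) =ᶠ[nhds q]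
        fun z => (fun z' => fderiv ℝ G z' (boostL g d w)) (boostL g d z) := by
      filter_upwards [hev] with z hz
      have := (hz.hasFDerivAt.comp z (boostL g d).hasFDerivAt).fderiv
      erw [this]
      rfl
    rw [this.fderiv_eq]
    have h2 : DifferentiableAt ℝ (fun z' => fderiv ℝ G z' (boostL g d w)) (boostL g d q) :=
      hD.clm_apply (differentiableAt_const _)
    have := (h2.hasFDerivAt.comp q (boostL g d).hasFDerivAt).fderiv
    erw [this]
    rfl
  have hsym := fun v w => fderiv_symm hG v w
  unfold boxOp
  simp only [key]
  generalize fderiv ℝ (fderiv ℝ G) (boostL g d q) = H at hsym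
  set k := g ^ 2 / (1 + g) with hk
  have hdsum : ((0 : ℝ), d) = ∑ i, d i • ((0 : ℝ), EuclideanSpace.single i (1 : ℝ)) := by
    ext i
    · simp [Prod.fst_sum]
    · simp [Prod.snd_sum, Pi.single_apply]
  have hn : ∑ i, d i ^ 2 = ‖d‖ ^ 2 := by
    rw [EuclideanSpace.norm_sq_eq]; simp
  have s0 : ∀ w, ∑ i, d i * H (0, EuclideanSpace.single i 1) w = H (0, d) w := by
    intro w
    rw [hdsum]; simp only [map_sum, sum_apply, map_smul, smul_apply, smul_eq_mul]
  have b0 : boostL g d (1, 0) = g • ((1 : ℝ), (0 : EuclideanSpace ℝ (Fin N))) - g • (0, d) := by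
    rw [boostL_apply]; simp
  have bi : ∀ i : Fin N, boostL g d (0, EuclideanSpace.single i 1)
      = (0, EuclideanSpace.single i 1) + (k * d i) • ((0 : ℝ), d)
        - (g * d i) • ((1 : ℝ), (0 : EuclideanSpace ℝ (Fin N))) := by
    intro i
    rw [boostL_apply]
    simp [EuclideanSpace.inner_single_right, hk]
  have hterm : ∀ i : Fin N, H (boostL g d (0, EuclideanSpace.single i 1))
      (boostL g d (0, EuclideanSpace.single i 1))
      = H (0, EuclideanSpace.single i 1) (0, EuclideanSpace.single i 1)
        + 2 * k * (d i * H (0, EuclideanSpace.single i 1) (0, d))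
        - 2 * g * (d i * H (0, EuclideanSpace.single i 1) (1, 0))
        + d i ^ 2 * (k ^ 2 * H (0, d) (0, d) - 2 * k * g * H (0, d) (1, 0)
          + g ^ 2 * H (1, 0) (1, 0)) := by
    intro i
    rw [bi]
    simp only [map_add, map_sub, map_smul, add_apply,
      sub_apply, smul_apply, smul_eq_mul]
    rw [hsym (0, EuclideanSpace.single i 1) (0, d), hsym (0, EuclideanSpace.single i 1) (1, 0),
      hsym (0, d) (1, 0)]
    ring
  simp only [hterm, Finset.sum_add_distrib, Finset.sum_sub_distrib, ← Finset.mul_sum,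
    ← Finset.sum_mul, s0, hn, b0]
  simp only [map_sub, map_smul,
      sub_apply, smul_apply, smul_eq_mul]
  rw [hsym (0, d) (1, 0)]
  have hk1 : k * (1 + g) = g ^ 2 := by rw [hk]; field_simp
  have hk2 : k * ‖d‖ ^ 2 = g - 1 := by
    have : (k * ‖d‖ ^ 2) * (1 + g) = (g - 1) * (1 + g) := by
      linear_combination ‖d‖ ^ 2 * hk1 - hgd
    exact mul_right_cancel₀ (by positivity) this
  have hn2 : g ^ 2 * ‖d‖ ^ 2 = g ^ 2 - 1 := by linear_combination -hgd
  linear_combination (-H (1, 0) (1, 0)) * hn2 + (2 * g * H (0, d) (1, 0) - k * H (0, d) (0, d)) * hk2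
    - H (0, d) (0, d) * hk1

lemma boost_minkowski {g : ℝ} {d : EuclideanSpace ℝ (Fin N)} (hg : 0 < g)
    (hgd : g ^ 2 * (1 - ‖d‖ ^ 2) = 1) (t : ℝ) (x : EuclideanSpace ℝ (Fin N)) :
    (boostL g d (t, x)).1 ^ 2 - ‖(boostL g d (t, x)).2‖ ^ 2 = t ^ 2 - ‖x‖ ^ 2 := by
  rw [boostL_apply]
  set k := g ^ 2 / (1 + g) with hk
  have hk1 : k * (1 + g) = g ^ 2 := by rw [hk]; field_simp
  have hk2 : k * ‖d‖ ^ 2 = g - 1 := by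
    have : (k * ‖d‖ ^ 2) * (1 + g) = (g - 1) * (1 + g) := by
      linear_combination ‖d‖ ^ 2 * hk1 - hgd
    exact mul_right_cancel₀ (by positivity) this
  have hn2 : g ^ 2 * ‖d‖ ^ 2 = g ^ 2 - 1 := by linear_combination -hgd
  have e : x - (g * t) • d + (k * ⟪d, x⟫) • d = x + (k * ⟪d, x⟫ - g * t) • d := by
    rw [sub_smul]; abel
  simp only [e]
  rw [norm_add_sq_real, norm_smul, mul_pow _ ‖d‖, Real.norm_eq_abs, sq_abs, inner_smul_right,
    real_inner_comm d x]
  generalize ⟪d, x⟫ = b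
  generalize ‖d‖ ^ 2 = n at *
  linear_combination (-t^2) * hn2 + (2 * g * t * b - k * b ^ 2) * hk2 - b ^ 2 * hk1

lemma inner_lt_one {d y : EuclideanSpace ℝ (Fin N)} (hd : ‖d‖ < 1) (hy : ‖y‖ < 1) :
    0 < 1 - ⟪d, y⟫ := by
  have h := real_inner_le_norm d y
  have : ‖d‖ * ‖y‖ < 1 := by nlinarith [norm_nonneg d, norm_nonneg y]
  linarith

lemma gamma_facts {d : EuclideanSpace ℝ (Fin N)} (hd : ‖d‖ < 1) :
    0 < (1 - ‖d‖ ^ 2) ^ (-(1 / 2) : ℝ) ∧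
    ((1 - ‖d‖ ^ 2) ^ (-(1 / 2) : ℝ)) ^ 2 * (1 - ‖d‖ ^ 2) = 1 := by
  have h : 0 < 1 - ‖d‖ ^ 2 := by nlinarith [norm_nonneg d]
  refine ⟨Real.rpow_pos_of_pos h _, ?_⟩
  rw [← Real.rpow_natCast, ← Real.rpow_mul h.le]
  norm_num
  rw [Real.rpow_neg_one]
  exact inv_mul_cancel₀ h.ne'

lemma ymap_eq (d y : EuclideanSpace ℝ (Fin N)) :
    ymap d y = (boostL ((1 - ‖d‖ ^ 2) ^ (-(1 / 2) : ℝ)) d (1, y)).1⁻¹ •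
      (boostL ((1 - ‖d‖ ^ 2) ^ (-(1 / 2) : ℝ)) d (1, y)).2 := by
  rw [boostL_apply]
  simp only [ymap, mul_one, mul_div_right_comm]

lemma ymap_norm {d y : EuclideanSpace ℝ (Fin N)} (hd : ‖d‖ < 1) (hy : ‖y‖ < 1) :
    ‖ymap d y‖ < 1 := by
  obtain ⟨hg, hgd⟩ := gamma_facts hd
  have h := boost_minkowski hg hgd 1 y
  have hm : 0 < (boostL ((1 - ‖d‖ ^ 2) ^ (-(1 / 2) : ℝ)) d (1, y)).1 := by
    rw [boostL_apply]
    exact mul_pos hg (inner_lt_one hd hy)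
  rw [ymap_eq, norm_smul, norm_inv, Real.norm_of_nonneg hm.le, inv_mul_lt_one₀ hm]
  apply lt_of_pow_lt_pow_left₀ 2 hm.le
  nlinarith [norm_nonneg y]

lemma ymap_inner {d y : EuclideanSpace ℝ (Fin N)} (hd : ‖d‖ < 1) (hy : ‖y‖ < 1) :
    1 + ⟪d, ymap d y⟫ = (1 - ‖d‖ ^ 2) / (1 - ⟪d, y⟫) := by
  obtain ⟨hg, hgd⟩ := gamma_facts hd
  have hi := inner_lt_one hd hy
  unfold ymap
  generalize (1 - ‖d‖ ^ 2) ^ (-(1 / 2) : ℝ) = g at *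
  rw [inner_smul_right, inner_add_right, inner_sub_right, inner_smul_right, inner_smul_right,
    real_inner_self_eq_norm_sq]
  generalize ⟪d, y⟫ = b at *
  have h1 : g ^ 2 * b / (1 + g) * ‖d‖ ^ 2 = b * (g - 1) := by
    have hn2 : g ^ 2 * ‖d‖ ^ 2 = g ^ 2 - 1 := by linear_combination -hgd
    field_simp
    linear_combination b * hn2
  rw [h1]
  field_simp
  ring

lemma lorentz_W {p s : ℝ} {d : EuclideanSpace ℝ (Fin N)} (hd : ‖d‖ < 1)
    (η : ℝ × EuclideanSpace ℝ (Fin N) → ℝ) {t : ℝ} {x : EuclideanSpace ℝ (Fin N)}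
    (ht : 0 < t) (hx : ‖x‖ < t) :
    Wf (2 / (p - 1)) s (lorentzSS p d η) (t, x)
      = Wf (2 / (p - 1)) (s + Real.log ((1 - ‖d‖ ^ 2) ^ (-(1 / 2) : ℝ))) η
        (boostL ((1 - ‖d‖ ^ 2) ^ (-(1 / 2) : ℝ)) d (t, x)) := by
  obtain ⟨hg, hgd⟩ := gamma_facts hd
  have hy : ‖t⁻¹ • x‖ < 1 := by
    rw [norm_smul, norm_inv, Real.norm_of_nonneg ht.le, inv_mul_lt_one₀ ht]; exact hx
  have hi := inner_lt_one hd hy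
  have e : boostL ((1 - ‖d‖ ^ 2) ^ (-(1 / 2) : ℝ)) d (t, x)
      = t • boostL ((1 - ‖d‖ ^ 2) ^ (-(1 / 2) : ℝ)) d (1, t⁻¹ • x) := by
    rw [← map_smul]
    congr 1
    simp [smul_smul, ht.ne']
  have e1 : (boostL ((1 - ‖d‖ ^ 2) ^ (-(1 / 2) : ℝ)) d (1, t⁻¹ • x)).1
      = (1 - ‖d‖ ^ 2) ^ (-(1 / 2) : ℝ) * (1 - ⟪d, t⁻¹ • x⟫) := by rw [boostL_apply]
  unfold Wf
  rw [e]
  simp only [lorentzSS, Prod.smul_fst, Prod.smul_snd, smul_eq_mul]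
  rw [ymap_eq, e1, smul_smul]
  generalize (1 - ‖d‖ ^ 2) ^ (-(1 / 2) : ℝ) = g at *
  generalize 1 - ⟪d, t⁻¹ • x⟫ = b at *
  rw [Real.mul_rpow (x := t) ht.le (by positivity), Real.log_mul ht.ne' (by positivity),
    Real.log_mul hg.ne' hi.ne', ← mul_assoc]
  congr 3
  · ring
  · congr 1
    field_simp

lemma kd_pow {p : ℝ} (hp : 1 < p) {d y : EuclideanSpace ℝ (Fin N)} (hd : ‖d‖ < 1)
    (hy : ‖y‖ < 1) :
    kd p d (ymap d y) ^ (p - 1) = 2 * (p + 1) / (p - 1) ^ 2 *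
      ((1 - ‖d‖ ^ 2) ^ (-(1 / 2) : ℝ) * (1 - ⟪d, y⟫)) ^ 2 := by
  obtain ⟨hg, hgd⟩ := gamma_facts hd
  have hi := inner_lt_one hd hy
  have h : 0 < 1 - ‖d‖ ^ 2 := by nlinarith [norm_nonneg d]
  have hp1 : 0 < p - 1 := by linarith
  have hp2 : 0 < p + 1 := by linarith
  unfold kd kappa0
  rw [ymap_inner hd hy]
  rw [Real.mul_rpow (by positivity) (by positivity), Real.mul_rpow (by positivity) (by positivity),
    ← Real.rpow_mul (by positivity), ← Real.rpow_mul (by positivity),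
    ← Real.rpow_mul (by positivity)]
  rw [show 1 / (p - 1) * (p - 1) = 1 by field_simp,
    show -(2 / (p - 1)) * (p - 1) = -2 by field_simp, Real.rpow_one, Real.rpow_one, mul_assoc]
  congr 1
  rw [Real.rpow_neg (by positivity)]
  generalize (1 - ‖d‖ ^ 2) ^ (-(1 / 2) : ℝ) = g at *
  norm_cast
  field_simp
  linear_combination -hgd

lemma lorentz_smooth {p : ℝ} {d : EuclideanSpace ℝ (Fin N)} (hd : ‖d‖ < 1)
    {η : ℝ × EuclideanSpace ℝ (Fin N) → ℝ}
    (hsmooth : ContDiffOn ℝ (⊤ : ℕ∞) η {q : ℝ × EuclideanSpace ℝ (Fin N) | ‖q.2‖ < 1}) :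
    ContDiffOn ℝ (⊤ : ℕ∞) (lorentzSS p d η)
      {q : ℝ × EuclideanSpace ℝ (Fin N) | ‖q.2‖ < 1} := by
  obtain ⟨hg, hgd⟩ := gamma_facts hd
  have hs2 : ContDiffOn ℝ (⊤ : ℕ∞) (fun q : ℝ × EuclideanSpace ℝ (Fin N) => q.2)
      {q | ‖q.2‖ < 1} := contDiff_snd.contDiffOn
  have hs1 : ContDiffOn ℝ (⊤ : ℕ∞) (fun q : ℝ × EuclideanSpace ℝ (Fin N) => q.1)
      {q | ‖q.2‖ < 1} := contDiff_fst.contDiffOn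
  have hb : ContDiffOn ℝ (⊤ : ℕ∞) (fun q : ℝ × EuclideanSpace ℝ (Fin N) => 1 - ⟪d, q.2⟫)
      {q | ‖q.2‖ < 1} := contDiffOn_const.sub (contDiffOn_const.inner ℝ hs2)
  have hbo : ContDiffOn ℝ (⊤ : ℕ∞) (fun q : ℝ × EuclideanSpace ℝ (Fin N) =>
      boostL ((1 - ‖d‖ ^ 2) ^ (-(1 / 2) : ℝ)) d (1, q.2)) {q | ‖q.2‖ < 1} :=
    (boostL _ d).contDiff.comp_contDiffOn (contDiffOn_const.prodMk hs2)
  have hym : ContDiffOn ℝ (⊤ : ℕ∞) (fun q : ℝ × EuclideanSpace ℝ (Fin N) => ymap d q.2)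
      {q | ‖q.2‖ < 1} := by
    simp only [ymap_eq]
    refine (hbo.fst.inv ?_).smul hbo.snd
    intro q hq
    rw [boostL_apply]
    exact (mul_pos hg (inner_lt_one hd hq)).ne'
  unfold lorentzSS
  refine ContDiffOn.mul ?_ ?_
  · refine (contDiffOn_const.mul hb).rpow_const_of_ne ?_
    intro q hq
    exact (mul_pos hg (inner_lt_one hd hq)).ne'
  · refine hsmooth.comp ((hs1.sub (hb.log ?_)).prodMk hym) ?_
    · intro q hq
      exact (inner_lt_one hd hq).ne'
    · intro q hq
      exact ymap_norm hd hq

lemma contDiffAt_two {η : ℝ × EuclideanSpace ℝ (Fin N) → ℝ}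
    (hsmooth : ContDiffOn ℝ (⊤ : ℕ∞) η {q : ℝ × EuclideanSpace ℝ (Fin N) | ‖q.2‖ < 1})
    {s : ℝ} {y : EuclideanSpace ℝ (Fin N)} (hy : ‖y‖ < 1) : ContDiffAt ℝ 2 η (s, y) := by
  have ho : IsOpen {q : ℝ × EuclideanSpace ℝ (Fin N) | ‖q.2‖ < 1} :=
    isOpen_lt (by fun_prop) (by fun_prop)
  have h : ContDiffAt ℝ (⊤ : ℕ∞) η (s, y) :=
    hsmooth.contDiffAt (ho.mem_nhds (show (s, y) ∈ {q : ℝ × EuclideanSpace ℝ (Fin N) | ‖q.2‖ < 1} from hy))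
  have h2 : (2 : WithTop ℕ∞) ≤ ((⊤ : ℕ∞) : WithTop ℕ∞) :=
    WithTop.coe_le_coe.2 (le_top : (2 : ℕ∞) ≤ ⊤)
  exact h.of_le h2

end LorentzAux

/-- If `η` is a smooth solution of the linearized self-similar equation around `κ_d` on
`ℝ × {|y| < 1}`, then `ξ = 𝒯_d η` is a smooth solution of the linearized self-similar
equation around `κ₀`, whose potential is the constant `p κ₀^{p−1} = 2p(p+1)/(p−1)²`. -/
theorem lorentz_transform_linearized (N : ℕ) (hN : 1 ≤ N) (p : ℝ) (hp : 1 < p)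
    (d : EuclideanSpace ℝ (Fin N)) (hd : ‖d‖ < 1)
    (η : ℝ × EuclideanSpace ℝ (Fin N) → ℝ)
    (hsmooth : ContDiffOn ℝ (⊤ : ℕ∞) η {q : ℝ × EuclideanSpace ℝ (Fin N) | ‖q.2‖ < 1})
    (hsol : ∀ (s : ℝ) (y : EuclideanSpace ℝ (Fin N)), ‖y‖ < 1 →
      LinEqAt p (fun z => p * kd p d z ^ (p - 1)) η s y) :
    ContDiffOn ℝ (⊤ : ℕ∞) (lorentzSS p d η)
      {q : ℝ × EuclideanSpace ℝ (Fin N) | ‖q.2‖ < 1} ∧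
    ∀ (s' : ℝ) (y' : EuclideanSpace ℝ (Fin N)), ‖y'‖ < 1 →
      LinEqAt p (fun _ => 2 * p * (p + 1) / (p - 1) ^ 2) (lorentzSS p d η) s' y' := by
  have hξ : ContDiffOn ℝ (⊤ : ℕ∞) (lorentzSS p d η)
      {q : ℝ × EuclideanSpace ℝ (Fin N) | ‖q.2‖ < 1} := lorentz_smooth hd hsmooth
  refine ⟨hξ, ?_⟩
  intro s' y' hy'
  obtain ⟨hg, hgd⟩ := gamma_facts hd
  have hi := inner_lt_one hd hy'
  have hym := ymap_norm hd hy'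
  have hL := fun t x => lorentz_W (p := p) (s := s') hd η (t := t) (x := x)
  have hkd := kd_pow hp hd hy'
  have hyeq := ymap_eq d y'
  have hval : lorentzSS p d η (s', y') = (((1 - ‖d‖ ^ 2) ^ (-(1 / 2) : ℝ)) * (1 - ⟪d, y'⟫))
      ^ (-(2 / (p - 1))) * η (s' - Real.log (1 - ⟪d, y'⟫), ymap d y') := rfl
  rw [linEqAt_iff hp (contDiffAt_two hξ hy')]
  have hη := (linEqAt_iff hp (contDiffAt_two hsmooth hym)).1
    (hsol (s' - Real.log (1 - ⟪d, y'⟫)) _ hym)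
  rw [hkd] at hη
  generalize (1 - ‖d‖ ^ 2) ^ (-(1 / 2) : ℝ) = g at *
  have hb1 : (boostL g d (1, y')).1 = g * (1 - ⟪d, y'⟫) := by rw [boostL_apply]
  have hm : 0 < g * (1 - ⟪d, y'⟫) := mul_pos hg hi
  have hlog : s' + Real.log g - Real.log (g * (1 - ⟪d, y'⟫)) = s' - Real.log (1 - ⟪d, y'⟫) := by
    rw [Real.log_mul hg.ne' hi.ne']; ring
  rw [hb1] at hyeq
  have hbq : boostL g d (1, y') = (g * (1 - ⟪d, y'⟫), (boostL g d (1, y')).2) := by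
    rw [← hb1]
  have h1 := boxOp_Wf (a := 2 / (p - 1)) (c := s') (F := lorentzSS p d η) (t := 1) (x := y')
    one_pos (by simpa using contDiffAt_two hξ hy')
  have h2 := boxOp_Wf (a := 2 / (p - 1)) (c := s' + Real.log g) (F := η)
    (t := g * (1 - ⟪d, y'⟫)) (x := (boostL g d (1, y')).2) hm
    (by rw [← hyeq]; exact contDiffAt_two hsmooth hym)
  rw [← hbq, hlog, ← hyeq] at h2
  have h3 := boxOp_boost hg hgd h2.1
  have h4 : boxOp (Wf (2 / (p - 1)) s' (lorentzSS p d η)) (1, y')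
      = boxOp (fun z => Wf (2 / (p - 1)) (s' + Real.log g) η (boostL g d z)) (1, y') := by
    have hev : Wf (2 / (p - 1)) s' (lorentzSS p d η) =ᶠ[nhds (1, y')]
        fun z => Wf (2 / (p - 1)) (s' + Real.log g) η (boostL g d z) := by
      have ho : IsOpen {q : ℝ × EuclideanSpace ℝ (Fin N) | ‖q.2‖ < q.1} :=
        isOpen_lt (by fun_prop) (by fun_prop)
      filter_upwards [ho.mem_nhds (show (1, y') ∈ _ from hy')] with q hq
      exact hL _ _ (lt_of_le_of_lt (norm_nonneg _) hq) hq
    unfold boxOp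
    rw [hev.fderiv.fderiv_eq]
  have h5 := h1.2
  rw [h4, h3, h2.2, hη] at h5
  simp only [Real.one_rpow, Real.log_one, sub_zero, inv_one, one_smul, one_pow, one_mul] at h5
  rw [← h5, hval]
  generalize (g * (1 - ⟪d, y'⟫)) ^ (-(2 / (p - 1))) = A
  have hp1 : p - 1 ≠ 0 := by linarith
  field_simp

end
end

section
/- Fix an integer N ≥ 1 and a real number p > 1, set s_p = 2/(p−1), and let d ∈ ℝ^N with |d| < 1, γ(d) = (1−|d|²)^{−1/2}. Define φ(y) = s_p κ₀ γ(d)^{−s_p} (1+d·y)^{−s_p−1} and χ(y) = s_p(s_p+1) κ₀ γ(d)^{−s_p} (1+d·y)^{−s_p−2}. Then for every y ∈ ℝ^N with 1 + d·y > 0 (in particular on every closed ball B̄_R with 1 ≤ R < |d|^{−1}): −y·∇φ(y) − s_p φ(y) + χ(y) = φ(y) and Δφ(y) + p κ_d(y)^{p−1} φ(y) − y·∇χ(y) − (1+s_p) χ(y) = χ(y); that is, (φ, χ) is an eigenfunction of the formal linearized operator around κ_d with eigenvalue 1. -/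
open scoped RealInnerProductSpace

noncomputable section

open scoped RealInnerProductSpace in
/-- Partial derivatives of powers of `1 + d⬝y`. -/
lemma pd_rpow_aux {N : ℕ} (d y : EuclideanSpace ℝ (Fin N)) (hy : 0 < 1 + ⟪d, y⟫)
    (C a : ℝ) (j : Fin N) :
    pd j (fun z => C * (1 + ⟪d, z⟫) ^ a) y = C * a * (1 + ⟪d, y⟫) ^ (a - 1) * d j := by
  have h1 : HasFDerivAt (fun z : EuclideanSpace ℝ (Fin N) => 1 + ⟪d, z⟫) (innerSL ℝ d) y :=
    ((innerSL ℝ d).hasFDerivAt (x := y)).const_add 1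
  have h2 := (h1.rpow_const (p := a) (Or.inl hy.ne')).const_mul C
  unfold pd
  rw [h2.fderiv]
  simp [EuclideanSpace.inner_single_right]
  ring

open scoped RealInnerProductSpace in
/-- Second partial derivatives of powers of `1 + d⬝y`. -/
lemma pd_pd_rpow_aux {N : ℕ} (d y : EuclideanSpace ℝ (Fin N)) (hy : 0 < 1 + ⟪d, y⟫)
    (C a : ℝ) (j : Fin N) :
    pd j (pd j (fun z => C * (1 + ⟪d, z⟫) ^ a)) y
      = C * a * (a - 1) * (1 + ⟪d, y⟫) ^ (a - 2) * (d j * d j) := by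
  have hc : Continuous (fun z : EuclideanSpace ℝ (Fin N) => 1 + ⟪d, z⟫) := by fun_prop
  have he : pd j (fun z => C * (1 + ⟪d, z⟫) ^ a)
      =ᶠ[nhds y] (fun z => (C * a * d j) * (1 + ⟪d, z⟫) ^ (a - 1)) := by
    filter_upwards [(isOpen_lt continuous_const hc).mem_nhds hy] with z hz
    rw [pd_rpow_aux d z hz]
    ring
  have h3 : pd j (pd j (fun z => C * (1 + ⟪d, z⟫) ^ a)) y
      = pd j (fun z => (C * a * d j) * (1 + ⟪d, z⟫) ^ (a - 1)) y := by
    conv_lhs => unfold pd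
    conv_rhs => unfold pd
    have := he.fderiv_eq (𝕜 := ℝ)
    exact congrArg (fun L => L (EuclideanSpace.single j 1)) this
  rw [h3, pd_rpow_aux d y hy, show a - 1 - 1 = a - 2 by ring]
  ring

open scoped RealInnerProductSpace in
/-- The potential term. -/
lemma kd_pow_aux {N : ℕ} (p : ℝ) (hp : 1 < p) (d y : EuclideanSpace ℝ (Fin N)) (hd : ‖d‖ < 1)
    (hy : 0 < 1 + ⟪d, y⟫) :
    kd p d y ^ (p - 1)
      = 2 * (p + 1) / (p - 1) ^ 2 * (1 - ‖d‖ ^ 2) * (1 + ⟪d, y⟫) ^ (-2 : ℝ) := by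
  have hp1 : 0 < p - 1 := by linarith
  have hk : 0 < 2 * (p + 1) / (p - 1) ^ 2 := by
    have : 0 < p + 1 := by linarith
    positivity
  have hd1 : 0 < 1 - ‖d‖ ^ 2 := by nlinarith [norm_nonneg d]
  unfold kd kappa0
  rw [Real.mul_rpow (by positivity) (by positivity), Real.mul_rpow (by positivity) (by positivity),
    ← Real.rpow_mul hk.le, ← Real.rpow_mul hd1.le, ← Real.rpow_mul hy.le]
  have e1 : 1 / (p - 1) * (p - 1) = 1 := by field_simp
  have e2 : -(2 / (p - 1)) * (p - 1) = -2 := by field_simp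
  rw [e1, e2, Real.rpow_one, Real.rpow_one]

/-- The symmetry mode `(φ, χ)` is an eigenfunction of the formal linearized operator
around `κ_d` with eigenvalue `1`. -/
theorem symmetry_mode_eigenvalue_one (N : ℕ) (hN : 1 ≤ N) (p : ℝ) (hp : 1 < p)
    (sp : ℝ) (hsp : sp = 2 / (p - 1))
    (d : EuclideanSpace ℝ (Fin N)) (hd : ‖d‖ < 1)
    (γ : ℝ) (hγ : γ = (1 - ‖d‖ ^ 2) ^ (-(1 / 2) : ℝ))
    (φ χ : EuclideanSpace ℝ (Fin N) → ℝ)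
    (hφ : ∀ y : EuclideanSpace ℝ (Fin N), φ y =
      sp * kappa0 p * γ ^ (-sp) * (1 + ⟪d, y⟫) ^ (-(sp + 1)))
    (hχ : ∀ y : EuclideanSpace ℝ (Fin N), χ y =
      sp * (sp + 1) * kappa0 p * γ ^ (-sp) * (1 + ⟪d, y⟫) ^ (-(sp + 2))) :
    ∀ y : EuclideanSpace ℝ (Fin N), 0 < 1 + ⟪d, y⟫ →
      (-(∑ j : Fin N, y j * pd j φ y) - sp * φ y + χ y = φ y) ∧
      ((∑ j : Fin N, pd j (pd j φ) y) + p * kd p d y ^ (p - 1) * φ y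
          - (∑ j : Fin N, y j * pd j χ y) - (1 + sp) * χ y = χ y) := by
  intro y hy
  have hp1 : p - 1 ≠ 0 := by linarith
  obtain ⟨A, hA⟩ : ∃ A, A = sp * kappa0 p * γ ^ (-sp) := ⟨_, rfl⟩
  have hφ' : φ = fun z => A * (1 + ⟪d, z⟫) ^ (-(sp + 1)) := by
    funext z; rw [hφ, hA]
  have hχ' : χ = fun z => ((sp + 1) * A) * (1 + ⟪d, z⟫) ^ (-(sp + 2)) := by
    funext z; rw [hχ, hA]; ring
  have hin : ∑ j : Fin N, y j * d j = ⟪d, y⟫ := by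
    simp [PiLp.inner_apply]
  have hnn : ∑ j : Fin N, d j * d j = ‖d‖ ^ 2 := by
    rw [EuclideanSpace.real_norm_sq_eq]
    exact Finset.sum_congr rfl fun j _ => by ring
  have hsum : ∀ C a : ℝ, ∑ j : Fin N, y j * pd j (fun z => C * (1 + ⟪d, z⟫) ^ a) y
      = C * a * (1 + ⟪d, y⟫) ^ (a - 1) * ⟪d, y⟫ := by
    intro C a
    rw [show C * a * (1 + ⟪d, y⟫) ^ (a - 1) * ⟪d, y⟫
      = C * a * (1 + ⟪d, y⟫) ^ (a - 1) * ∑ j : Fin N, y j * d j by rw [hin], Finset.mul_sum]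
    refine Finset.sum_congr rfl fun j _ => ?_
    rw [pd_rpow_aux d y hy]; ring
  have hlap : ∀ C a : ℝ, ∑ j : Fin N, pd j (pd j (fun z => C * (1 + ⟪d, z⟫) ^ a)) y
      = C * a * (a - 1) * (1 + ⟪d, y⟫) ^ (a - 2) * ‖d‖ ^ 2 := by
    intro C a
    rw [← hnn, Finset.mul_sum]
    exact Finset.sum_congr rfl fun j _ => pd_pd_rpow_aux d y hy C a j
  rw [hφ', hχ', hsum, hsum, hlap, kd_pow_aux p hp d y hd hy]
  obtain ⟨w, hw⟩ : ∃ w, w = 1 + ⟪d, y⟫ := ⟨_, rfl⟩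
  have hin' : ⟪d, y⟫ = w - 1 := by rw [hw]; ring
  simp only [← hw]
  rw [hin']
  rw [← hw] at hy
  obtain ⟨E, hE⟩ : ∃ E, E = w ^ (-(sp + 3)) := ⟨_, rfl⟩
  have hE2 : w ^ (-(sp + 2)) = E * w := by
    rw [hE, ← Real.rpow_add_one hy.ne']; congr 1; ring
  have hE1 : w ^ (-(sp + 1)) = E * w ^ 2 := by
    rw [hE, ← Real.rpow_add_natCast hy.ne']; congr 1; push_cast; ring
  have hw2 : w ^ (-2 : ℝ) = (w ^ 2)⁻¹ := by
    rw [Real.rpow_neg hy.le]; norm_num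
  rw [show -(sp + 1) - 1 = -(sp + 2) by ring, show -(sp + 2) - 1 = -(sp + 3) by ring,
    show -(sp + 1) - 2 = -(sp + 3) by ring, hE2, hE1, ← hE, hw2]
  refine ⟨by ring, ?_⟩
  have hk : p * (2 * (p + 1) / (p - 1) ^ 2) = (sp + 1) * (sp + 2) := by
    rw [hsp]; field_simp; ring
  have hpot : p * (2 * (p + 1) / (p - 1) ^ 2 * (1 - ‖d‖ ^ 2) * (w ^ 2)⁻¹) * (A * (E * w ^ 2))
      = (sp + 1) * (sp + 2) * (1 - ‖d‖ ^ 2) * A * E := by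
    rw [← hk]; field_simp
  rw [hpot]
  ring


end
end

section
/- Fix an integer N ≥ 1 and a real number p > 1, and let d ∈ ℝ^N with |d| < 1. Then λ ∈ ℂ is an eigenvalue of the linearized operator around κ_d if and only if λ is an eigenvalue of the linearized operator around κ₀; that is, the eigen-equation for (d, λ) admits a solution smooth on the closed unit ball and not identically zero there if and only if the eigen-equation for (0, λ) does. -/
open scoped RealInnerProductSpace

noncomputable section

namespace EigAux

open scoped Topology

abbrev E (N : ℕ) := EuclideanSpace ℝ (Fin N)

/-- Second derivative of a composition with an affine map. -/
lemma snd_comp {F G : Type*} [NormedAddCommGroup F] [NormedSpace ℝ F]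
    [NormedAddCommGroup G] [NormedSpace ℝ G] (f : F → ℂ) (c : F) (M : G →L[ℝ] F) (y : G)
    (hf : ContDiffAt ℝ 2 f (c + M y)) (u v : G) :
    fderiv ℝ (fderiv ℝ (fun z => f (c + M z))) y u v
      = fderiv ℝ (fderiv ℝ f) (c + M y) (M u) (M v) := by
  have hA : ∀ z, HasFDerivAt (fun z => c + M z) M z := fun z => M.hasFDerivAt.const_add c
  have hev : ∀ᶠ q in 𝓝 (c + M y), DifferentiableAt ℝ f q := by
    filter_upwards [hf.eventually (by simp)] with q hq
    exact hq.differentiableAt (by simp)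
  have h1 : fderiv ℝ (fun z => f (c + M z)) =ᶠ[𝓝 y]
      fun z => (fderiv ℝ f (c + M z)).comp M := by
    filter_upwards [(hA y).continuousAt.eventually hev] with z hz
    exact (hz.hasFDerivAt.comp z (hA z)).fderiv
  rw [h1.fderiv_eq]
  have h2 : DifferentiableAt ℝ (fderiv ℝ f) (c + M y) :=
    (hf.fderiv_right (m := 1) (by norm_num)).differentiableAt (by simp)
  have h3 := h2.hasFDerivAt.comp y (hA y)
  have h4 := h3.clm_comp (hasFDerivAt_const M y)
  have h5 : (fun z => (fderiv ℝ f (c + M z)).comp M) =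
      fun z => ((fderiv ℝ f ∘ fun z => c + M z) z).comp M := rfl
  rw [h5, h4.fderiv]
  simp

lemma fst_comp {F G : Type*} [NormedAddCommGroup F] [NormedSpace ℝ F]
    [NormedAddCommGroup G] [NormedSpace ℝ G] (f : F → ℂ) (c : F) (M : G →L[ℝ] F) (y : G)
    (hf : ContDiffAt ℝ 2 f (c + M y)) (u : G) :
    fderiv ℝ (fun z => f (c + M z)) y u = fderiv ℝ f (c + M y) (M u) := by
  have hA : HasFDerivAt (fun z => c + M z) M y := M.hasFDerivAt.const_add c
  have := ((hf.differentiableAt (by simp)).hasFDerivAt.comp y hA).fderiv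
  have h5 : (fun z => f (c + M z)) = f ∘ (fun z => c + M z) := rfl
  rw [h5, this]; simp

/-- unit time vector -/
def e0 (N : ℕ) : ℝ × E N := (1, 0)

/-- unit space vector -/
def ei {N : ℕ} (i : Fin N) : ℝ × E N := (0, EuclideanSpace.single i 1)

/-- trace of a bilinear form against the Minkowski metric -/
def mtr {N : ℕ} (B : (ℝ × E N) →L[ℝ] (ℝ × E N) →L[ℝ] ℂ) : ℂ :=
  B (e0 N) (e0 N) - ∑ i, B (ei i) (ei i)

/-- the wave operator -/
def box {N : ℕ} (w : ℝ × E N → ℂ) (q : ℝ × E N) : ℂ := mtr (fderiv ℝ (fderiv ℝ w) q)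

lemma sum_vec {N : ℕ} (x : E N) : ∑ i, x i • (EuclideanSpace.single i (1:ℝ) : E N) = x := by
  ext j
  simp [Finset.sum_apply, Pi.single_apply]

lemma sum_vec' {N : ℕ} (x : E N) : ∑ i, x i • (ei i : ℝ × E N) = (0, x) := by
  have h0 : ((0, x) : ℝ × E N) = ContinuousLinearMap.inr ℝ ℝ (E N) x := rfl
  rw [h0]
  conv_rhs => rw [← sum_vec x]
  rw [map_sum]
  refine Finset.sum_congr rfl fun i _ => ?_
  rw [map_smul]; rfl

/-- Euler relations for a homogeneous function. -/
lemma euler {N : ℕ} (w : ℝ × E N → ℂ) (a : ℂ) (q : ℝ × E N) (hw : ContDiffAt ℝ 2 w q)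
    (hom : ∀ᶠ z in 𝓝 q, ∀ r : ℝ, 0 < r → w (r • z) = Complex.exp (-a * Real.log r) * w z) :
    fderiv ℝ w q q = -a * w q ∧
    ∀ v, fderiv ℝ (fderiv ℝ w) q v q = -(a + 1) * fderiv ℝ w q v := by
  have hev : ∀ᶠ z in 𝓝 q, DifferentiableAt ℝ w z := by
    filter_upwards [hw.eventually (by simp)] with z hz
    exact hz.differentiableAt (by simp)
  have key : ∀ᶠ z in 𝓝 q, fderiv ℝ w z z = -a * w z := by
    filter_upwards [hom, hev] with z hz hd
    have h1 : HasDerivAt (fun r : ℝ => r • z) z 1 := by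
      simpa using (hasDerivAt_id (1:ℝ)).smul_const z
    have hd' : HasFDerivAt w (fderiv ℝ w z) ((1:ℝ) • z) := by
      rw [one_smul]; exact hd.hasFDerivAt
    have h2 : HasDerivAt (fun r : ℝ => w (r • z)) (fderiv ℝ w z z) 1 :=
      hd'.comp_hasDerivAt (1:ℝ) h1
    have h3 : HasDerivAt (fun r : ℝ => Complex.exp (-a * Real.log r) * w z)
        (-a * w z) 1 := by
      have := (((Real.hasDerivAt_log one_ne_zero).ofReal_comp.const_mul (-a)).cexp).mul_const (w z)
      simpa using this
    have h4 : (fun r : ℝ => w (r • z)) =ᶠ[𝓝 1]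
        (fun r : ℝ => Complex.exp (-a * Real.log r) * w z) := by
      filter_upwards [lt_mem_nhds (zero_lt_one' ℝ)] with r hr
      exact hz r hr
    exact h2.unique (h3.congr_of_eventuallyEq h4)
  refine ⟨key.self_of_nhds, fun v => ?_⟩
  have h2 : DifferentiableAt ℝ (fderiv ℝ w) q :=
    (hw.fderiv_right (m := 1) (by norm_num)).differentiableAt (by simp)
  have h3 := h2.hasFDerivAt.clm_apply (hasFDerivAt_id q)
  have h4 := (hev.self_of_nhds).hasFDerivAt.const_mul (-a)
  have h5 := (h3.unique (h4.congr_of_eventuallyEq key))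
  have h6 := congrArg (fun T => T v) h5
  simp at h6
  linear_combination h6

lemma eigen_iff {N : ℕ} (p : ℝ) (hp : 1 < p) (d : E N) (lam : ℂ) (w : ℝ × E N → ℂ) (y : E N)
    (hw : ContDiffAt ℝ 2 w (1, y))
    (hom : ∀ᶠ z in 𝓝 ((1, y) : ℝ × E N), ∀ r : ℝ, 0 < r →
      w (r • z) = Complex.exp (-(lam + ((2 / (p - 1) : ℝ) : ℂ)) * Real.log r) * w z) :
    EigenEqAt p d lam (fun x => w (1, x)) y ↔
      box w (1, y) = ((p * kd p d y ^ (p - 1) : ℝ) : ℂ) * w (1, y) := by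
  set a : ℂ := lam + ((2 / (p - 1) : ℝ) : ℂ) with ha
  set φ : E N → ℂ := fun x => w (1, x) with hφ
  have hφ' : φ = fun x => w (e0 N + ContinuousLinearMap.inr ℝ ℝ (E N) x) := by
    funext x; simp [hφ, e0]
  have hpt : e0 N + ContinuousLinearMap.inr ℝ ℝ (E N) y = (1, y) := by simp [e0]
  have hD1 : ∀ u, fderiv ℝ φ y u = fderiv ℝ w (1, y) (0, u) := by
    intro u
    rw [hφ', fst_comp w (e0 N) _ y (by rw [hpt]; exact hw), hpt]; rfl
  have hD2 : ∀ u v, fderiv ℝ (fderiv ℝ φ) y u v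
      = fderiv ℝ (fderiv ℝ w) (1, y) (0, u) (0, v) := by
    intro u v
    rw [hφ', snd_comp w (e0 N) _ y (by rw [hpt]; exact hw), hpt]; rfl
  have hφc : ContDiffAt ℝ 2 φ y := by
    have : ContDiffAt ℝ 2 (fun x : E N => ((1:ℝ), x)) y := by fun_prop
    exact ContDiffAt.comp y hw this
  have hφd : DifferentiableAt ℝ (fderiv ℝ φ) y :=
    (hφc.fderiv_right (m := 1) (by norm_num)).differentiableAt (by simp)
  have hpp : ∀ i j, pdC i (pdC j φ) y
      = fderiv ℝ (fderiv ℝ w) (1, y) (ei i) (ei j) := by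
    intro i j
    have h := (hφd.hasFDerivAt.clm_apply
      (hasFDerivAt_const (EuclideanSpace.single j (1:ℝ) : E N) y)).fderiv
    have : pdC i (pdC j φ) y = fderiv ℝ (fderiv ℝ φ) y
        (EuclideanSpace.single i 1) (EuclideanSpace.single j 1) := by
      change fderiv ℝ (fun z => fderiv ℝ φ z (EuclideanSpace.single j 1)) y
        (EuclideanSpace.single i 1) = _
      rw [h]; simp
    rw [this, hD2]; rfl
  set B := fderiv ℝ (fderiv ℝ w) (1, y) with hB
  have hS1 : ∑ i : Fin N, (y i : ℂ) * pdC i φ y = fderiv ℝ w (1, y) (0, y) := by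
    rw [← sum_vec' y, map_sum]
    refine Finset.sum_congr rfl fun i _ => ?_
    rw [map_smul, Complex.real_smul]
    congr 1
    exact hD1 _
  have hS2 : (∑ i : Fin N, ∑ j : Fin N,
        (((y i * y j - if i = j then (1 : ℝ) else 0) : ℝ) : ℂ) * pdC i (pdC j φ) y)
      = B (0, y) (0, y) - ∑ i, B (ei i) (ei i) := by
    have h1 : B (0, y) (0, y) = ∑ i, ∑ j, ((y i * y j : ℝ) : ℂ) * B (ei i) (ei j) := by
      conv_lhs => rw [← sum_vec' y]
      rw [map_sum B, _root_.sum_apply]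
      refine Finset.sum_congr rfl fun i _ => ?_
      rw [map_sum]
      refine Finset.sum_congr rfl fun j _ => ?_
      simp only [map_smul, _root_.smul_apply, Complex.real_smul]
      push_cast; ring
    rw [h1, ← Finset.sum_sub_distrib]
    refine Finset.sum_congr rfl fun i _ => ?_
    have : B (ei i) (ei i) = ∑ j, (if i = j then B (ei i) (ei j) else 0) := by simp
    rw [this, ← Finset.sum_sub_distrib]
    refine Finset.sum_congr rfl fun j _ => ?_
    rw [hpp]
    split_ifs <;> push_cast <;> ring
  obtain ⟨hE1, hE2⟩ := euler w a (1, y) hw hom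
  have hsym : IsSymmSndFDerivAt ℝ w (1, y) := hw.isSymmSndFDerivAt (by simp)
  have he0 : e0 N = (1, y) - (0, y) := by simp [e0]
  have h00 : B (e0 N) (e0 N) = a * (a + 1) * w (1, y)
      + 2 * (a + 1) * fderiv ℝ w (1, y) (0, y) + B (0, y) (0, y) := by
    rw [he0]
    simp only [map_sub, _root_.sub_apply]
    have hs : B (1, y) (0, y) = B (0, y) (1, y) := hsym.eq _ _
    rw [hs, hE2, hE2, hE1]; ring
  unfold EigenEqAt box mtr
  rw [hS1, hS2, ← hB, h00]
  have hp0 : ((p:ℂ) - 1) ≠ 0 := by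
    have : (p - 1 : ℝ) ≠ 0 := by linarith
    exact_mod_cast this
  have c1 : lam ^ 2 + (((p + 3) / (p - 1) : ℝ) : ℂ) * lam
      + ((2 * (p + 1) / (p - 1) ^ 2 : ℝ) : ℂ) = a * (a + 1) := by
    rw [ha]; push_cast; field_simp; ring
  have c2 : 2 * lam + ((2 * (p + 1) / (p - 1) : ℝ) : ℂ) = 2 * (a + 1) := by
    rw [ha]; push_cast; field_simp; ring
  rw [c1, c2]
  constructor <;> intro h <;> linear_combination h

/-- The Lorentz boost as a linear map. -/
def L {N : ℕ} (β : E N) (g : ℝ) : (ℝ × E N) →L[ℝ] (ℝ × E N) :=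
  (g • (ContinuousLinearMap.fst ℝ ℝ (E N)
      + (innerSL ℝ β).comp (ContinuousLinearMap.snd ℝ ℝ (E N)))).prod
    (ContinuousLinearMap.snd ℝ ℝ (E N)
      + (g • ContinuousLinearMap.fst ℝ ℝ (E N) + (g ^ 2 / (1 + g)) •
          (innerSL ℝ β).comp (ContinuousLinearMap.snd ℝ ℝ (E N))).smulRight β)

lemma L_apply {N : ℕ} (β : E N) (g : ℝ) (q : ℝ × E N) :
    L β g q = (g * (q.1 + ⟪β, q.2⟫), q.2 + (g * q.1 + g ^ 2 / (1 + g) * ⟪β, q.2⟫) • β) := by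
  simp [L, mul_add]

lemma mu_rel {b g : ℝ} (hg : 0 < g) (h : g ^ 2 * (1 - b) = 1) :
    g ^ 2 / (1 + g) * b = g - 1 := by
  field_simp
  linarith

lemma L_inv {N : ℕ} (β : E N) (g : ℝ) (hg : 0 < g) (h : g ^ 2 * (1 - ‖β‖ ^ 2) = 1)
    (q : ℝ × E N) : L β g (L (-β) g q) = q := by
  have hm := mu_rel hg h
  have hm2 : g ^ 2 / (1 + g) * (1 + g) = g ^ 2 := by field_simp
  simp only [L_apply, inner_add_right, inner_neg_left, inner_neg_right, inner_smul_right,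
    real_inner_self_eq_norm_sq, smul_neg]
  set m := g ^ 2 / (1 + g) with hmdef
  obtain ⟨t, x⟩ := q
  ext1
  · simp only
    generalize ⟪β, x⟫ = c
    linear_combination t * h + g * c * hm
  · simp only
    rw [add_assoc, add_eq_left, ← neg_smul, ← add_smul]
    refine smul_eq_zero_of_left ?_ _
    generalize ⟪β, x⟫ = c
    linear_combination (-g * t + m * c) * hm + c * hm2

lemma L_quad {N : ℕ} (β : E N) (g : ℝ) (hg : 0 < g) (h : g ^ 2 * (1 - ‖β‖ ^ 2) = 1)
    (q : ℝ × E N) : (L β g q).1 ^ 2 - ‖(L β g q).2‖ ^ 2 = q.1 ^ 2 - ‖q.2‖ ^ 2 := by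
  have hm := mu_rel hg h
  have hm2 : g ^ 2 / (1 + g) * (1 + g) = g ^ 2 := by field_simp
  rw [L_apply]
  simp only [← real_inner_self_eq_norm_sq]
  simp only [inner_add_right, inner_add_left, inner_smul_right, inner_smul_left,
    real_inner_self_eq_norm_sq, real_inner_comm β]
  set m := g ^ 2 / (1 + g) with hmdef
  obtain ⟨t, x⟩ := q
  simp only [conj_trivial]
  generalize ⟪β, x⟫ = c
  generalize ‖β‖ ^ 2 = b at *
  linear_combination t^2 * h - (2 * g * t * c + m * c ^2) * hm - c^2 * hm2

lemma mtr_L {N : ℕ} (β : E N) (g : ℝ) (hg : 0 < g) (h : g ^ 2 * (1 - ‖β‖ ^ 2) = 1)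
    (B : (ℝ × E N) →L[ℝ] (ℝ × E N) →L[ℝ] ℂ) :
    B (L β g (e0 N)) (L β g (e0 N)) - ∑ i, B (L β g (ei i)) (L β g (ei i)) = mtr B := by
  have hm := mu_rel hg h
  have hm2 : g ^ 2 / (1 + g) * (1 + g) = g ^ 2 := by field_simp
  set m := g ^ 2 / (1 + g) with hmdef
  have h0 : L β g (e0 N) = g • e0 N + g • ((0, β) : ℝ × E N) := by
    rw [L_apply]; simp [e0]
  set v : ℝ × E N := g • e0 N + m • ((0, β) : ℝ × E N) with hv
  have hi : ∀ i, L β g (ei i) = ei i + β i • v := by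
    intro i
    rw [L_apply]
    have : ⟪β, (EuclideanSpace.single i (1:ℝ) : E N)⟫ = β i := by
      simp [EuclideanSpace.inner_single_right]
    simp only [ei, this, hv, e0]
    ext1
    · simp [mul_comm]
    · simp [smul_smul, mul_comm, hmdef]
  have hn : ∑ i, β i * β i = ‖β‖ ^ 2 := by
    rw [EuclideanSpace.real_norm_sq_eq]
    exact Finset.sum_congr rfl fun i _ => by ring
  have hsum : ∑ i, B (L β g (ei i)) (L β g (ei i)) = ∑ i, B (ei i) (ei i)
      + B (0, β) v + B v (0, β) + ((‖β‖ ^ 2 : ℝ) : ℂ) * B v v := by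
    rw [← hn]
    conv_rhs => rw [← sum_vec' β]
    rw [map_sum, map_sum, _root_.sum_apply]
    push_cast
    rw [Finset.sum_mul, ← Finset.sum_add_distrib, ← Finset.sum_add_distrib,
      ← Finset.sum_add_distrib]
    refine Finset.sum_congr rfl fun i _ => ?_
    rw [hi]
    simp only [map_add, map_smul, _root_.add_apply, _root_.smul_apply,
      Complex.real_smul]
    ring
  rw [hsum, h0, hv]
  unfold mtr
  simp only [map_add, map_smul, _root_.add_apply, _root_.smul_apply,
      Complex.real_smul]
  generalize ‖β‖ ^ 2 = b at *
  have h' : (g:ℂ) ^ 2 * (1 - (b:ℂ)) = 1 := by exact_mod_cast h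
  have hm' : (m:ℂ) * b = g - 1 := by exact_mod_cast hm
  have hm2' : (m:ℂ) * (1 + g) = g ^ 2 := by exact_mod_cast hm2
  generalize B (e0 N) (e0 N) = A
  generalize B (e0 N) (0, β) = A1
  generalize B (0, β) (e0 N) = A2
  generalize B (0, β) (0, β) = A3
  linear_combination A * h' - g * A1 * hm' - g * A2 * hm' - m * A3 * hm' - A3 * hm2'

lemma kd_pow {N : ℕ} (p : ℝ) (hp : 1 < p) (d y : E N) (hd : ‖d‖ < 1) (hy : 0 < 1 + ⟪d, y⟫) :
    kd p d y ^ (p - 1) = 2 * (p + 1) / (p - 1) ^ 2 * ((1 - ‖d‖ ^ 2) / (1 + ⟪d, y⟫) ^ 2) := by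
  have hp1 : 0 < p - 1 := by linarith
  have hd2 : 0 < 1 - ‖d‖ ^ 2 := by nlinarith [norm_nonneg d]
  have hk : 0 < 2 * (p + 1) / (p - 1) ^ 2 := by positivity
  unfold kd kappa0
  rw [Real.mul_rpow (by positivity) (by positivity), Real.mul_rpow (by positivity) (by positivity),
    ← Real.rpow_mul hk.le, ← Real.rpow_mul hd2.le, ← Real.rpow_mul hy.le]
  have e1 : 1 / (p - 1) * (p - 1) = 1 := by field_simp
  have e2 : -(2 / (p - 1)) * (p - 1) = -(2:ℝ) := by field_simp
  rw [e1, e2, Real.rpow_one, Real.rpow_one, Real.rpow_neg hy.le, Real.rpow_two]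
  field_simp

lemma inner_pos' {N : ℕ} (d y : E N) (hd : ‖d‖ < 1) (hy : ‖y‖ ≤ 1) : 0 < 1 + ⟪d, y⟫ := by
  have h1 := abs_real_inner_le_norm d y
  have h2 := (abs_le.mp h1).1
  nlinarith [norm_nonneg d, norm_nonneg y]

/-- the homogeneous extension -/
def hext {N : ℕ} (a : ℂ) (φ : E N → ℂ) (q : ℝ × E N) : ℂ :=
  Complex.exp (-a * Real.log q.1) * φ (q.1⁻¹ • q.2)

lemma hext_hom {N : ℕ} (a : ℂ) (φ : E N → ℂ) (q : ℝ × E N) (hq : 0 < q.1) (r : ℝ) (hr : 0 < r) :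
    hext a φ (r • q) = Complex.exp (-a * Real.log r) * hext a φ q := by
  unfold hext
  have : (r • q).1⁻¹ • (r • q).2 = q.1⁻¹ • q.2 := by
    simp only [Prod.smul_fst, Prod.smul_snd, smul_eq_mul, smul_smul]
    congr 1; field_simp
  rw [this, Prod.smul_fst, smul_eq_mul, Real.log_mul hr.ne' hq.ne', ← mul_assoc, ← Complex.exp_add]
  congr 2; push_cast; ring

lemma hext_smooth {N : ℕ} (a : ℂ) (φ : E N → ℂ) (q : ℝ × E N) (hq : 0 < q.1)
    (h : ContDiffAt ℝ (⊤ : ℕ∞) φ (q.1⁻¹ • q.2)) : ContDiffAt ℝ (⊤ : ℕ∞) (hext a φ) q := by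
  have h1 : ContDiffAt ℝ (⊤ : ℕ∞) (fun q : ℝ × E N => q.1⁻¹ • q.2) q :=
    (contDiffAt_fst.inv hq.ne').smul contDiffAt_snd
  have h2 : ContDiffAt ℝ (⊤ : ℕ∞) (fun q : ℝ × E N => φ (q.1⁻¹ • q.2)) q :=
    ContDiffAt.comp q h h1
  have h3 : ContDiffAt ℝ (⊤ : ℕ∞) (fun q : ℝ × E N => ((Real.log q.1 : ℝ) : ℂ)) q :=
    Complex.ofRealCLM.contDiff.contDiffAt.comp q (contDiffAt_fst.log hq.ne')
  exact ((contDiffAt_const.mul h3).cexp).mul h2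

theorem transfer (N : ℕ) (p : ℝ) (hp : 1 < p) (d d' β : E N) (hd : ‖d‖ < 1) (hd' : ‖d'‖ < 1)
    (hβ : ‖β‖ < 1) (g : ℝ) (hg : 0 < g) (hgβ : g ^ 2 * (1 - ‖β‖ ^ 2) = 1)
    (hpot : ∀ y : E N, (1 - ‖d'‖ ^ 2) * ((L β g (1, y)).1 + ⟪d, (L β g (1, y)).2⟫) ^ 2
      = (1 - ‖d‖ ^ 2) * (1 + ⟪d', y⟫) ^ 2)
    (lam : ℂ) (H : IsEigenvalue N p d lam) : IsEigenvalue N p d' lam := by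
  obtain ⟨φ, Ω, hΩ, hsub, hφ, heq, y0, hy0, hne⟩ := H
  set a : ℂ := lam + ((2 / (p - 1) : ℝ) : ℂ) with ha
  set w := hext a φ with hw
  set C : Set (ℝ × E N) := {q | 0 < q.1 ∧ q.1⁻¹ • q.2 ∈ Ω} with hC
  have hCo : IsOpen C := by
    have hc : ContinuousOn (fun q : ℝ × E N => q.1⁻¹ • q.2) {q | 0 < q.1} := by
      intro q hq
      exact ((continuousAt_fst.inv₀ (ne_of_gt hq)).smul continuousAt_snd).continuousWithinAt
    exact hc.isOpen_inter_preimage (isOpen_lt continuous_const continuous_fst) hΩ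
  have hws : ∀ q ∈ C, ContDiffAt ℝ (⊤ : ℕ∞) w q := fun q hq =>
    hext_smooth a φ q hq.1 (hφ.contDiffAt (hΩ.mem_nhds hq.2))
  have hcone : ∀ γ : E N, ‖γ‖ < 1 → g ^ 2 * (1 - ‖γ‖ ^ 2) = 1 → ∀ y ∈ Metric.closedBall (0 : E N) 1,
      0 < (L γ g (1, y)).1 ∧
      (L γ g (1, y)).1⁻¹ • (L γ g (1, y)).2 ∈ Metric.closedBall (0 : E N) 1 := by
    intro γ hγ hgγ y hy
    rw [mem_closedBall_zero_iff] at hy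
    have hT : 0 < (L γ g (1, y)).1 := by
      rw [L_apply]; exact mul_pos hg (inner_pos' γ y hγ hy)
    refine ⟨hT, ?_⟩
    have hq := L_quad γ g hg hgγ (1, y)
    rw [mem_closedBall_zero_iff, norm_smul, norm_inv, Real.norm_of_nonneg hT.le,
      inv_mul_le_iff₀ hT, mul_one]
    refine abs_le_of_sq_le_sq' ?_ hT.le |>.2
    simp only at hq
    nlinarith [norm_nonneg y]
  have hcont : Continuous (fun y : E N => L β g (1, y)) := by fun_prop
  have hLC : ∀ y ∈ Metric.closedBall (0 : E N) 1, L β g (1, y) ∈ C := fun y hy =>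
    ⟨(hcone β hβ hgβ y hy).1, hsub (hcone β hβ hgβ y hy).2⟩
  refine ⟨fun y => w (L β g (1, y)), (fun y => L β g (1, y)) ⁻¹' C, hCo.preimage hcont, hLC,
    ?_, ?_, ?_⟩
  · intro y hy
    have h1 : ContDiffAt ℝ (⊤ : ℕ∞) (fun y : E N => L β g (1, y)) y := by fun_prop
    exact (ContDiffAt.comp y (hws _ hy) h1).contDiffWithinAt
  · intro y hy
    set q := L β g (1, y) with hqdef
    obtain ⟨hT, hY⟩ := hcone β hβ hgβ y hy
    have hqC := hLC y hy
    rw [← hqdef] at hT hY hqC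
    set T := q.1 with hTdef
    set Y := T⁻¹ • q.2 with hYdef
    have hTY : (1, Y) = T⁻¹ • q := by
      ext1
      · simp [← hTdef, hT.ne']
      · simp [hYdef]
    have h1C : ((1, Y) : ℝ × E N) ∈ C := by
      refine ⟨by simp, ?_⟩
      simpa using hsub hY
    have hle : (2 : WithTop ℕ∞) ≤ ((⊤ : ℕ∞) : WithTop ℕ∞) := by
      have : ((2 : ℕ∞) : WithTop ℕ∞) ≤ ((⊤ : ℕ∞) : WithTop ℕ∞) :=
        WithTop.coe_le_coe.2 le_top
      exact this
    have hw1 : ContDiffAt ℝ 2 w (1, Y) := (hws _ h1C).of_le hle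
    have hwq : ContDiffAt ℝ 2 w q := (hws _ hqC).of_le hle
    have hhom : ∀ q0 : ℝ × E N, 0 < q0.1 → ∀ᶠ z in 𝓝 q0, ∀ r : ℝ, 0 < r →
        w (r • z) = Complex.exp (-a * Real.log r) * w z := by
      intro q0 hq0
      filter_upwards [(isOpen_lt continuous_const continuous_fst).mem_nhds hq0] with z hz r hr
      exact hext_hom a φ z hz r hr
    have hw0 : (fun x => w (1, x)) = φ := by
      funext x; simp [hw, hext]
    have hbox := (eigen_iff p hp d lam w Y hw1 (hhom _ (by simp))).1 (by rw [hw0]; exact heq Y hY)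
    have hwL : ContDiffAt ℝ 2 (fun z => w (L β g z)) (1, y) :=
      ContDiffAt.comp (f := fun z => L β g z) (1, y) hwq (L β g).contDiff.contDiffAt
    have hres := eigen_iff p hp d' lam (fun z => w (L β g z)) y hwL (by
      filter_upwards [(L β g).continuous.continuousAt.eventually (hhom q hT)] with z hz r hr
      rw [map_smul]; exact hz r hr)
    refine hres.2 ?_
    -- the scaled map
    set M : (ℝ × E N) →L[ℝ] (ℝ × E N) := T⁻¹ • L β g with hM
    have hMq : M (1, y) = (1, Y) := by rw [hTY, hM]; rfl
    have hloc : (fun z => w (L β g z)) =ᶠ[𝓝 (1, y)]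
        fun z => Complex.exp (-a * Real.log T) * w (0 + M z) := by
      have : ∀ᶠ z in 𝓝 ((1, y) : ℝ × E N), 0 < (M z).1 := by
        refine (isOpen_lt continuous_const (continuous_fst.comp M.continuous)).mem_nhds ?_
        simp [hMq]
      filter_upwards [this] with z hz
      rw [zero_add, ← hext_hom a φ (M z) hz T hT]
      congr 1
      simp [hM, smul_smul, hT.ne']
    have hMc : ContDiffAt ℝ 2 w (0 + M (1, y)) := by rw [zero_add, hMq]; exact hw1
    have hsnd : ∀ u v, fderiv ℝ (fderiv ℝ (fun z => w (L β g z))) (1, y) u v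
        = Complex.exp (-a * Real.log T) *
          (((T⁻¹ : ℝ) : ℂ) ^ 2 * fderiv ℝ (fderiv ℝ w) (1, Y) (L β g u) (L β g v)) := by
      intro u v
      have hf1 := hloc.fderiv (𝕜 := ℝ)
      have hMd : ContDiffAt ℝ 2 (fun z => w (0 + M z)) (1, y) := by
        have hin : ContDiffAt ℝ 2 (fun z => 0 + M z) (1, y) :=
          (contDiff_const.add M.contDiff).contDiffAt
        exact ContDiffAt.comp (f := fun z => 0 + M z) (1, y) hMc hin
      have hf2 : fderiv ℝ (fun z => Complex.exp (-a * Real.log T) * w (0 + M z)) =ᶠ[𝓝 (1, y)]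
          fun z => Complex.exp (-a * Real.log T) • fderiv ℝ (fun z => w (0 + M z)) z := by
        filter_upwards [hMd.eventually (by simp)] with z hz
        exact fderiv_const_mul (hz.differentiableAt (by simp)) _
      rw [(hf1.trans hf2).fderiv_eq]
      have hdd : DifferentiableAt ℝ (fderiv ℝ (fun z => w (0 + M z))) (1, y) :=
        (hMd.fderiv_right (m := 1) (by norm_num)).differentiableAt (by simp)
      rw [fderiv_fun_const_smul hdd]
      simp only [_root_.smul_apply, smul_eq_mul]
      rw [snd_comp w 0 M (1, y) hMc, zero_add, hMq, hM]
      simp only [_root_.smul_apply, map_smul, Complex.real_smul]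
      ring
    have hboxL : box (fun z => w (L β g z)) (1, y)
        = Complex.exp (-a * Real.log T) * (((T⁻¹ : ℝ) : ℂ) ^ 2 * box w (1, Y)) := by
      unfold box
      rw [← mtr_L β g hg hgβ (fderiv ℝ (fderiv ℝ w) (1, Y))]
      conv_lhs => unfold mtr
      simp only [hsnd]
      rw [← Finset.mul_sum, ← Finset.mul_sum]
      ring
    rw [hboxL, hbox]
    have hwq' : w q = Complex.exp (-a * Real.log T) * w (1, Y) := by
      have := hext_hom a φ (1, Y) (by simp) T hT
      rw [← this, hTY, smul_smul, mul_inv_cancel₀ hT.ne', one_smul]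
    rw [← hqdef, hwq']
    have hy1 : ‖y‖ ≤ 1 := by simpa using hy
    have hY1 : ‖Y‖ ≤ 1 := by simpa using hY
    have hkk : T⁻¹ ^ 2 * (p * kd p d Y ^ (p - 1)) = p * kd p d' y ^ (p - 1) := by
      have hp1 := inner_pos' d Y hd hY1
      have hp2 := inner_pos' d' y hd' hy1
      rw [kd_pow p hp d Y hd hp1, kd_pow p hp d' y hd' hp2]
      have hin : T + ⟪d, q.2⟫ = T * (1 + ⟪d, Y⟫) := by
        rw [hYdef, inner_smul_right]; field_simp
      have hpo := hpot y
      rw [← hqdef, ← hTdef, hin] at hpo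
      have : T⁻¹ ^ 2 * ((1 - ‖d‖ ^ 2) / (1 + ⟪d, Y⟫) ^ 2)
          = (1 - ‖d'‖ ^ 2) / (1 + ⟪d', y⟫) ^ 2 := by
        rw [inv_pow, inv_mul_eq_div, div_div, div_eq_div_iff (by positivity) (by positivity)]
        linear_combination -hpo
      rw [← this]; ring
    rw [← hkk]
    push_cast
    ring
  · have hnβ : ‖-β‖ < 1 := by rwa [norm_neg]
    obtain ⟨hT, hY⟩ := hcone (-β) hnβ (by rwa [norm_neg]) y0 hy0
    set q := L (-β) g (1, y0) with hqdef
    set T := q.1 with hTdef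
    refine ⟨T⁻¹ • q.2, hY, ?_⟩
    have hTY : ((1, T⁻¹ • q.2) : ℝ × E N) = T⁻¹ • q := by
      ext1
      · simp [← hTdef, hT.ne']
      · simp
    change w (L β g (1, T⁻¹ • q.2)) ≠ 0
    rw [hTY, map_smul, hqdef, L_inv β g hg hgβ, hw,
      hext_hom a φ (1, y0) (by simp) _ (inv_pos.2 hT)]
    refine mul_ne_zero (Complex.exp_ne_zero _) ?_
    simpa [hext] using hne

end EigAux

/-- Equivalence of the discrete spectra: `λ` is an eigenvalue of the linearized operator
around `κ_d` iff it is an eigenvalue of the linearized operator around `κ₀`. -/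
theorem eigenvalue_equivalence (N : ℕ) (hN : 1 ≤ N) (p : ℝ) (hp : 1 < p)
    (d : EuclideanSpace ℝ (Fin N)) (hd : ‖d‖ < 1) (lam : ℂ) :
    IsEigenvalue N p d lam ↔ IsEigenvalue N p (0 : EuclideanSpace ℝ (Fin N)) lam := by
  have hd2 : 0 < 1 - ‖d‖ ^ 2 := by nlinarith [norm_nonneg d]
  have hg : 0 < (Real.sqrt (1 - ‖d‖ ^ 2))⁻¹ := inv_pos.2 (Real.sqrt_pos.2 hd2)
  have hgd : (Real.sqrt (1 - ‖d‖ ^ 2))⁻¹ ^ 2 * (1 - ‖d‖ ^ 2) = 1 := by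
    rw [inv_pow, Real.sq_sqrt hd2.le, inv_mul_cancel₀ hd2.ne']
  generalize (Real.sqrt (1 - ‖d‖ ^ 2))⁻¹ = g at hg hgd
  constructor
  · refine EigAux.transfer N p hp d 0 (-d) hd (by simp) (by rwa [norm_neg]) g hg
      (by rwa [norm_neg]) ?_ lam
    intro y
    have hm := EigAux.mu_rel hg hgd
    simp only [EigAux.L_apply, inner_add_right, inner_neg_left, inner_neg_right,
      inner_smul_right, real_inner_self_eq_norm_sq, norm_zero, inner_zero_left]
    set m := g ^ 2 / (1 + g)
    generalize ⟪d, y⟫ = c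
    have h1 : g * (1 + -c) + (c + (g * 1 + m * -c) * -‖d‖ ^ 2) = g * (1 - ‖d‖ ^ 2) := by
      linear_combination c * hm
    have h2 : g * (1 + -c) + (c + (g * 1 + m * -c) * -(‖d‖ ^ 2)) = g * (1 - ‖d‖ ^ 2) := by
      linear_combination c * hm
    rw [h2]
    linear_combination (1 - ‖d‖ ^ 2) * hgd
  · refine EigAux.transfer N p hp 0 d d (by simp) hd hd g hg hgd ?_ lam
    intro y
    simp only [EigAux.L_apply, norm_zero, inner_zero_left]
    linear_combination (1 + ⟪d, y⟫) ^ 2 * hgd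


end
end
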